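/- arXiv:1005.0702 — 8 statements merged into one kernel-verified Lean document; each statement's English description precedes it below -/
import Mathlib

section
/- Let f : I ⊆ [0, ∞) → ℝ be differentiable on I°, a, b ∈ I with a < b, and f' integrable on [a, b]. If |f'| is s-convex in the second sense on [a, b] for some fixed s ∈ (0, 1], then |f((a+b)/2) − (1/(b−a)) ∫_a^b f(u) du| ≤ ((b−a)/((s+1)(s+2))) · (1 − 1/2^{s+1}) · [|f'(a)| + |f'(b)|]. -/
open Set MeasureTheory intervalIntegral

/-- If `|f'| ≤ H'` on `(a, b)`, then increments of `f` are dominated by increments of `H`. -/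
theorem abs_sub_le_sub_of_abs_deriv_le {f H h : ℝ → ℝ} {a b : ℝ}
    (hf : DifferentiableOn ℝ f (Ioo a b)) (hH : ∀ t, HasDerivAt H (h t) t)
    (hfh : ∀ t ∈ Ioo a b, |deriv f t| ≤ h t) {x y : ℝ} (hx : x ∈ Ioo a b) (hy : y ∈ Ioo a b)
    (hxy : x ≤ y) : |f y - f x| ≤ H y - H x := by
  have hfd : ∀ t ∈ Ioo a b, HasDerivAt f (deriv f t) t := fun t ht =>
    ((hf t ht).differentiableAt (isOpen_Ioo.mem_nhds ht)).hasDerivAt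
  have hadd : MonotoneOn (fun t => H t + f t) (Ioo a b) := by
    refine monotoneOn_of_hasDerivWithinAt_nonneg (f' := fun t => h t + deriv f t)
      (convex_Ioo a b)
      (fun t ht => ((hH t).add (hfd t ht)).continuousAt.continuousWithinAt) ?_ ?_ <;>
    intro t ht <;> rw [interior_Ioo] at ht
    · exact ((hH t).add (hfd t ht)).hasDerivWithinAt
    · linarith [neg_abs_le (deriv f t), hfh t ht]
  have hsub : MonotoneOn (fun t => H t - f t) (Ioo a b) := by
    refine monotoneOn_of_hasDerivWithinAt_nonneg (f' := fun t => h t - deriv f t)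
      (convex_Ioo a b)
      (fun t ht => ((hH t).sub (hfd t ht)).continuousAt.continuousWithinAt) ?_ ?_ <;>
    intro t ht <;> rw [interior_Ioo] at ht
    · exact ((hH t).sub (hfd t ht)).hasDerivWithinAt
    · linarith [le_abs_self (deriv f t), hfh t ht]
  have h₁ := hadd hx hy hxy
  have h₂ := hsub hx hy hxy
  simp only at h₁ h₂
  exact abs_le.2 ⟨by linarith, by linarith⟩

/-- Midpoint inequality for a function whose derivative is dominated by `K''`, with `K' = H` and
`H' = h`. -/
theorem abs_midpoint_sub_average_le {f K H h : ℝ → ℝ} {a b : ℝ} (hab : a < b)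
    (hf : DifferentiableOn ℝ f (Ioo a b)) (hK : ∀ t, HasDerivAt K (H t) t)
    (hH : ∀ t, HasDerivAt H (h t) t) (hfh : ∀ t ∈ Ioo a b, |deriv f t| ≤ h t) :
    |f ((a + b) / 2) - (1 / (b - a)) * ∫ u in a..b, f u|
      ≤ (K a + K b - 2 * K ((a + b) / 2)) / (b - a) := by
  set m := (a + b) / 2 with hm
  have ham : a < m := by linarith
  have hmb : m < b := by linarith
  have hL : 0 < b - a := sub_pos.2 hab
  have hHc : Continuous H := continuous_iff_continuousAt.2 fun t => (hH t).continuousAt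
  have hbound : ∀ u ∈ Ioo a b, |f m - f u| ≤ |H m - H u| := by
    intro u hu
    rcases le_total u m with hum | hmu
    · exact (abs_sub_le_sub_of_abs_deriv_le hf hH hfh hu ⟨ham, hmb⟩ hum).trans (le_abs_self _)
    · rw [abs_sub_comm, abs_sub_comm (H m)]
      exact (abs_sub_le_sub_of_abs_deriv_le hf hH hfh ⟨ham, hmb⟩ hu hmu).trans (le_abs_self _)
  have hH_mono : MonotoneOn H (Icc a b) := by
    refine monotoneOn_of_hasDerivWithinAt_nonneg (f' := h) (convex_Icc a b)
      hHc.continuousOn (fun t _ => (hH t).hasDerivWithinAt) fun t ht => ?_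
    rw [interior_Icc] at ht
    exact (abs_nonneg _).trans (hfh t ht)
  have hdom : IntegrableOn (fun u => |H m - H u|) (Ioo a b) :=
    ((continuous_const.sub hHc).abs.integrableOn_Icc).mono_set Ioo_subset_Icc_self
  have hdiff_int : IntegrableOn (fun u => f m - f u) (Ioo a b) := by
    refine Integrable.mono' hdom
      ((continuousOn_const.sub hf.continuousOn).aestronglyMeasurable measurableSet_Ioo) ?_
    exact (ae_restrict_iff' measurableSet_Ioo).2 (Filter.Eventually.of_forall hbound)
  have hdiff_int' : IntervalIntegrable (fun u => f m - f u) volume a b :=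
    (intervalIntegrable_iff_integrableOn_Ioo_of_le hab.le).2 hdiff_int
  have hf_int : IntervalIntegrable f volume a b := by
    simpa using (intervalIntegrable_const (c := f m)).sub hdiff_int'
  have hsplit : f m - (1 / (b - a)) * ∫ u in a..b, f u =
      (∫ u in a..b, (f m - f u)) / (b - a) := by
    rw [intervalIntegral.integral_sub intervalIntegrable_const hf_int,
      intervalIntegral.integral_const, smul_eq_mul]
    field_simp
  have hle : |∫ u in a..b, (f m - f u)| ≤ ∫ u in a..b, |H m - H u| := by
    rw [intervalIntegral.integral_of_le hab.le, intervalIntegral.integral_of_le hab.le,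
      integral_Ioc_eq_integral_Ioo, integral_Ioc_eq_integral_Ioo]
    rw [← Real.norm_eq_abs]
    exact norm_integral_le_of_norm_le hdom
      ((ae_restrict_iff' measurableSet_Ioo).2 (Filter.Eventually.of_forall hbound))
  have hHi : ∀ c d, IntervalIntegrable H volume c d := fun c d => hHc.intervalIntegrable c d
  have hleft : ∫ u in a..m, |H m - H u| = (m - a) * H m - (K m - K a) := by
    rw [intervalIntegral.integral_congr (g := fun u => H m - H u),
      intervalIntegral.integral_sub intervalIntegrable_const (hHi _ _),
      integral_eq_sub_of_hasDerivAt (fun t _ => hK t) (hHi _ _),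
      intervalIntegral.integral_const, smul_eq_mul]
    intro u hu
    rw [uIcc_of_le ham.le] at hu
    exact abs_of_nonneg
      (sub_nonneg.2 (hH_mono ⟨hu.1, hu.2.trans hmb.le⟩ ⟨ham.le, hmb.le⟩ hu.2))
  have hright : ∫ u in m..b, |H m - H u| = (K b - K m) - (b - m) * H m := by
    rw [intervalIntegral.integral_congr (g := fun u => H u - H m),
      intervalIntegral.integral_sub (hHi _ _) intervalIntegrable_const,
      integral_eq_sub_of_hasDerivAt (fun t _ => hK t) (hHi _ _),
      intervalIntegral.integral_const, smul_eq_mul]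
    intro u hu
    rw [uIcc_of_le hmb.le] at hu
    simp only
    rw [abs_sub_comm]
    exact abs_of_nonneg
      (sub_nonneg.2 (hH_mono ⟨ham.le, hmb.le⟩ ⟨ham.le.trans hu.1, hu.2⟩ hu.1))
  have habs : ∀ c d, IntervalIntegrable (fun u => |H m - H u|) volume c d := fun c d =>
    (continuous_const.sub hHc).abs.intervalIntegrable c d
  rw [← integral_add_adjacent_intervals (habs a m) (habs m b), hleft, hright] at hle
  rw [hsplit, abs_div, abs_of_pos hL]
  refine div_le_div_of_nonneg_right (hle.trans_eq ?_) hL.le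
  rw [hm]
  ring

/-- The derivative of `A ((b - t) / L) ^ p + B ((t - a) / L) ^ p` for `1 ≤ p`. -/
theorem hasDerivAt_rpow_combination (A B a b L : ℝ) {p : ℝ} (hp : 1 ≤ p) (t : ℝ) :
    HasDerivAt (fun t => A * ((b - t) / L) ^ p + B * ((t - a) / L) ^ p)
      (p / L * (-A * ((b - t) / L) ^ (p - 1) + B * ((t - a) / L) ^ (p - 1))) t := by
  have h₁ : HasDerivAt (fun t => (b - t) / L) (-1 / L) t :=
    ((hasDerivAt_id t).const_sub b).div_const L
  have h₂ : HasDerivAt (fun t => (t - a) / L) (1 / L) t :=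
    ((hasDerivAt_id t).sub_const a).div_const L
  refine (((h₁.rpow_const (Or.inr hp)).const_mul A).add
    ((h₂.rpow_const (Or.inr hp)).const_mul B)).congr_deriv ?_
  ring

/-- Corollary 2.2: midpoint inequality when `|f'|` is `s`-convex in the second sense. -/
theorem midpoint_sconvex_abs_deriv
    (f : ℝ → ℝ) (I : Set ℝ) (hI : Convex ℝ I) (hI0 : I ⊆ Ici (0:ℝ))
    (a b : ℝ) (ha : a ∈ I) (hb : b ∈ I) (hab : a < b)
    (hdiff : DifferentiableOn ℝ f (interior I))
    (hint : IntervalIntegrable (deriv f) volume a b)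
    (s : ℝ) (hs : s ∈ Ioc (0:ℝ) 1)
    (hconv : ∀ u ∈ Icc a b, ∀ v ∈ Icc a b, ∀ α ∈ Icc (0:ℝ) 1,
      |deriv f (α * u + (1 - α) * v)| ≤ α ^ s * |deriv f u| + (1 - α) ^ s * |deriv f v|) :
    |f ((a + b) / 2) - (1 / (b - a)) * ∫ u in a..b, f u|
      ≤ (b - a) / ((s + 1) * (s + 2)) * (1 - 1 / 2 ^ (s + 1)) *
        (|deriv f a| + |deriv f b|) := by
  obtain ⟨hs0, hs1⟩ := hs
  have hL : 0 < b - a := sub_pos.2 hab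
  have hf : DifferentiableOn ℝ f (Ioo a b) := hdiff.mono <|
    interior_maximal (Ioo_subset_Icc_self.trans (hI.ordConnected.out ha hb)) isOpen_Ioo
  set A := |deriv f a|
  set B := |deriv f b|
  have hbound : ∀ t ∈ Ioo a b,
      |deriv f t| ≤ A * ((b - t) / (b - a)) ^ s + B * ((t - a) / (b - a)) ^ s := by
    intro t ht
    have h := hconv a (left_mem_Icc.2 hab.le) b (right_mem_Icc.2 hab.le) ((b - t) / (b - a))
      ⟨div_nonneg (by linarith [ht.2]) hL.le, (div_le_one hL).2 (by linarith [ht.1])⟩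
    have hone : 1 - (b - t) / (b - a) = (t - a) / (b - a) := by
      field_simp
      ring
    have hpt : (b - t) / (b - a) * a + (t - a) / (b - a) * b = t := by
      field_simp
      ring
    rw [hone, hpt] at h
    linarith
  have hH : ∀ t, HasDerivAt
      (fun t => (b - a) / (s + 1) *
        (-A * ((b - t) / (b - a)) ^ (s + 1) + B * ((t - a) / (b - a)) ^ (s + 1)))
      (A * ((b - t) / (b - a)) ^ s + B * ((t - a) / (b - a)) ^ s) t := by
    intro t
    refine ((hasDerivAt_rpow_combination (-A) B a b (b - a) (p := s + 1) (by linarith)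
      t).const_mul ((b - a) / (s + 1))).congr_deriv ?_
    rw [add_sub_cancel_right]
    field_simp
  have hK : ∀ t, HasDerivAt
      (fun t => (b - a) ^ 2 / ((s + 1) * (s + 2)) *
        (A * ((b - t) / (b - a)) ^ (s + 2) + B * ((t - a) / (b - a)) ^ (s + 2)))
      ((b - a) / (s + 1) *
        (-A * ((b - t) / (b - a)) ^ (s + 1) + B * ((t - a) / (b - a)) ^ (s + 1))) t := by
    intro t
    refine ((hasDerivAt_rpow_combination A B a b (b - a) (p := s + 2) (by linarith)
      t).const_mul ((b - a) ^ 2 / ((s + 1) * (s + 2)))).congr_deriv ?_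
    rw [show s + 2 - 1 = s + 1 by ring]
    field_simp
  refine (abs_midpoint_sub_average_le hab hf hK hH hbound).trans_eq ?_
  have hhalf₁ : (b - (a + b) / 2) / (b - a) = 1 / 2 := by
    field_simp
    ring
  have hhalf₂ : ((a + b) / 2 - a) / (b - a) = 1 / 2 := by
    field_simp
    ring
  have hpow : (1 / 2 : ℝ) ^ (s + 2) = 1 / 2 ^ (s + 1) / 2 := by
    rw [Real.div_rpow zero_le_one zero_le_two, Real.one_rpow,
      show s + 2 = s + 1 + 1 by ring, Real.rpow_add_one two_ne_zero, div_div]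
  simp only [hhalf₁, hhalf₂, hpow, sub_self, zero_div, div_self hL.ne', Real.one_rpow,
    Real.zero_rpow (show s + 2 ≠ 0 by linarith)]
  field_simp
  ring
end

section
/- Let f : I ⊆ [0, ∞) → ℝ be differentiable on I°, a, b ∈ I with a < b, and f' integrable on [a, b]. Let p > 1 and q = p/(p−1). If |f'|^q is convex on [a, b], then |f((a+b)/2) − (1/(b−a)) ∫_a^b f(u) du| ≤ ((b−a)/16) · (4/(p+1))^{1/p} · [ (|f'(a)|^q + 3|f'(b)|^q)^{1/q} + (3|f'(a)|^q + |f'(b)|^q)^{1/q} ]. -/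
open Set MeasureTheory intervalIntegral

lemma ConvexOn.le_chord {g : ℝ → ℝ} {x y t : ℝ} (hxy : x < y) (hg : ConvexOn ℝ (Icc x y) g)
    (ht : t ∈ Icc x y) : g t ≤ (y - t) / (y - x) * g x + (t - x) / (y - x) * g y := by
  have hpos : 0 < y - x := sub_pos.2 hxy
  have h := hg.2 (left_mem_Icc.2 hxy.le) (right_mem_Icc.2 hxy.le)
    (div_nonneg (sub_nonneg.2 ht.2) hpos.le) (div_nonneg (sub_nonneg.2 ht.1) hpos.le)
    (by field_simp; ring)
  have ht' : (y - t) / (y - x) * x + (t - x) / (y - x) * y = t := by field_simp; ring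
  simpa only [smul_eq_mul, ht'] using h

lemma ConvexOn.intervalIntegral_le {g : ℝ → ℝ} {x y : ℝ} (hxy : x < y)
    (hg : ConvexOn ℝ (Icc x y) g) (hint : IntervalIntegrable g volume x y) :
    ∫ t in x..y, g t ≤ (y - x) * ((g x + g y) / 2) := by
  have hpos : 0 < y - x := sub_pos.2 hxy
  have hmono := integral_mono_on (μ := volume) hxy.le hint
    (Continuous.intervalIntegrable (by fun_prop) x y) (fun t ht => hg.le_chord hxy ht)
  have hcalc : ∫ t in x..y, ((y - t) / (y - x) * g x + (t - x) / (y - x) * g y)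
      = (y - x) * ((g x + g y) / 2) := by
    have hlin : ∀ t : ℝ, (y - t) / (y - x) * g x + (t - x) / (y - x) * g y
        = (y * g x - x * g y) / (y - x) + (g y - g x) / (y - x) * t := by
      intro t; field_simp; ring
    simp_rw [hlin]
    rw [intervalIntegral.integral_add (by simp) (Continuous.intervalIntegrable (by fun_prop) _ _),
      intervalIntegral.integral_const, intervalIntegral.integral_const_mul, integral_id,
      smul_eq_mul]
    field_simp
    ring
  exact hmono.trans_eq hcalc

lemma integral_abs_sub_endpoint_rpow {x y e p : ℝ} (hxy : x ≤ y) (hp : 0 < p)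
    (he : e = x ∨ e = y) :
    ∫ t in x..y, |t - e| ^ p = (y - x) ^ (p + 1) / (p + 1) := by
  have hbase : ∫ t in (0 : ℝ)..(y - x), t ^ p = (y - x) ^ (p + 1) / (p + 1) := by
    rw [integral_rpow (Or.inl (by linarith)), Real.zero_rpow (by linarith), sub_zero]
  rw [← hbase]
  rcases he with rfl | rfl
  · rw [← sub_self e, ← intervalIntegral.integral_comp_sub_right (fun t => t ^ p)]
    refine integral_congr fun t ht => ?_
    rw [uIcc_of_le hxy] at ht
    simp only [abs_of_nonneg (sub_nonneg.2 ht.1)]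
  · rw [← sub_self e, ← intervalIntegral.integral_comp_sub_left (fun t => t ^ p)]
    refine integral_congr fun t ht => ?_
    rw [uIcc_of_le hxy] at ht
    simp only [abs_sub_comm t, abs_of_nonneg (sub_nonneg.2 ht.2)]

/-- Hölder's inequality combined with the Hermite-Hadamard inequality for `|φ| ^ q`. -/
lemma abs_integral_sub_endpoint_mul_le {φ : ℝ → ℝ} {x y e p q : ℝ} (hxy : x < y)
    (hpq : p.HolderConjugate q) (he : e = x ∨ e = y)
    (hφ : IntervalIntegrable φ volume x y)
    (hconv : ConvexOn ℝ (Icc x y) (fun t => |φ t| ^ q)) :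
    |∫ t in x..y, (t - e) * φ t|
      ≤ (y - x) ^ 2 * (1 / (p + 1)) ^ (1 / p) * ((|φ x| ^ q + |φ y| ^ q) / 2) ^ (1 / q) := by
  have hp := hpq.pos
  have hq := hpq.symm.pos
  have hpos : 0 < y - x := sub_pos.2 hxy
  set μ := volume.restrict (Ioc x y)
  have hφb : ∀ t ∈ Ioc x y, ‖φ t‖ ≤ (max (|φ x| ^ q) (|φ y| ^ q)) ^ (1 / q) := by
    intro t ht
    rw [one_div, Real.le_rpow_inv_iff_of_pos (norm_nonneg _) (by positivity) hq]
    exact hconv.le_max_of_mem_Icc (left_mem_Icc.2 hxy.le) (right_mem_Icc.2 hxy.le)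
      (Ioc_subset_Icc_self ht)
  have hφLp : MemLp φ (ENNReal.ofReal q) μ :=
    MemLp.of_bound hφ.1.aestronglyMeasurable _
      ((ae_restrict_iff' measurableSet_Ioc).2 (ae_of_all _ hφb))
  have hwLp : MemLp (fun t => t - e) (ENNReal.ofReal p) μ := by
    refine MemLp.of_bound (by fun_prop) (y - x)
      ((ae_restrict_iff' measurableSet_Ioc).2 (ae_of_all _ fun t ht => ?_))
    rw [Real.norm_eq_abs, abs_le]
    rcases he with rfl | rfl <;> constructor <;> linarith [ht.1, ht.2]
  have hφq : IntervalIntegrable (fun t => |φ t| ^ q) volume x y := by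
    rw [intervalIntegrable_iff_integrableOn_Ioc_of_le hxy.le]
    have h := hφLp.integrable_norm_rpow (by simpa using hq) ENNReal.ofReal_ne_top
    simp only [ENNReal.toReal_ofReal hq.le, Real.norm_eq_abs] at h
    exact h
  have hHolder := integral_mul_norm_le_Lp_mul_Lq hpq hwLp hφLp
  simp only [μ, Real.norm_eq_abs, ← integral_of_le hxy.le] at hHolder
  rw [integral_abs_sub_endpoint_rpow hxy.le hp he] at hHolder
  have hexp : (p + 1) * (1 / p) + 1 / q = 2 := by
    have := hpq.inv_add_inv_eq_one
    have hpp : p * p⁻¹ = 1 := mul_inv_cancel₀ hp.ne'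
    simp only [one_div]
    linarith
  calc |∫ t in x..y, (t - e) * φ t|
      ≤ ∫ t in x..y, |t - e| * |φ t| := by
        simpa only [abs_mul] using
          abs_integral_le_integral_abs (f := fun t => (t - e) * φ t) (μ := volume) hxy.le
    _ ≤ ((y - x) ^ (p + 1) / (p + 1)) ^ (1 / p) * (∫ t in x..y, |φ t| ^ q) ^ (1 / q) := hHolder
    _ ≤ ((y - x) ^ (p + 1) / (p + 1)) ^ (1 / p)
          * ((y - x) * ((|φ x| ^ q + |φ y| ^ q) / 2)) ^ (1 / q) := by
        gcongr
        · exact integral_nonneg hxy.le fun t _ => by positivity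
        · exact hconv.intervalIntegral_le hxy hφq
    _ = _ := by
        rw [div_eq_mul_one_div, Real.mul_rpow (by positivity) (by positivity),
          Real.mul_rpow hpos.le (by positivity), ← Real.rpow_mul hpos.le,
          ← Real.rpow_natCast (y - x) 2, Nat.cast_ofNat, ← hexp, Real.rpow_add hpos]
        ring

/-- Midpoint inequality (1.5): for `p > 1`, `q = p/(p−1)`, and `|f'|^q` convex on `[a, b]`. -/
theorem midpoint_convex_pow_deriv_holder
    (f : ℝ → ℝ) (I : Set ℝ) (hI : Convex ℝ I) (hI0 : I ⊆ Ici (0:ℝ))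
    (a b : ℝ) (ha : a ∈ I) (hb : b ∈ I) (hab : a < b)
    (hdiff : DifferentiableOn ℝ f (interior I))
    (hint : IntervalIntegrable (deriv f) volume a b)
    (p q : ℝ) (hp : 1 < p) (hq : q = p / (p - 1))
    (hconv : ConvexOn ℝ (Icc a b) (fun t => |deriv f t| ^ q)) :
    |f ((a + b) / 2) - (1 / (b - a)) * ∫ u in a..b, f u|
      ≤ (b - a) / 16 * (4 / (p + 1)) ^ (1 / p) *
        ((|deriv f a| ^ q + 3 * |deriv f b| ^ q) ^ (1 / q)
          + (3 * |deriv f a| ^ q + |deriv f b| ^ q) ^ (1 / q)) := by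
  have hp0 : 0 < p := by linarith
  have hpq : p.HolderConjugate q := by
    rw [hq]; exact Real.HolderConjugate.conjExponent hp
  have hq0 := hpq.symm.pos
  have hpos : 0 < b - a := sub_pos.2 hab
  set φ := deriv f
  obtain ⟨c, hc⟩ : ∃ c, c = (a + b) / 2 := ⟨_, rfl⟩
  have hac : a < c := by linarith
  have hcb : c < b := by linarith
  have hIoo : Ioo a b ⊆ interior I :=
    interior_maximal (Ioo_subset_Icc_self.trans (hI.ordConnected.out ha hb)) isOpen_Ioo
  have hf : ∀ t ∈ Ioo a b, DifferentiableAt ℝ f t := fun t ht =>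
    hdiff.differentiableAt (isOpen_interior.mem_nhds (hIoo ht))
  have hbound : ∀ t ∈ Ioo a b,
      ‖φ t‖₊ ≤ ((max (|φ a| ^ q) (|φ b| ^ q)) ^ (1 / q)).toNNReal := by
    intro t ht
    rw [← norm_toNNReal]
    refine Real.toNNReal_le_toNNReal ?_
    rw [one_div, Real.le_rpow_inv_iff_of_pos (norm_nonneg _) (by positivity) hq0]
    exact hconv.le_max_of_mem_Icc (left_mem_Icc.2 hab.le) (right_mem_Icc.2 hab.le)
      (Ioo_subset_Icc_self ht)
  -- `f` may be discontinuous at `a` and `b`, so replace it by a Lipschitz extension from `(a, b)`.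
  obtain ⟨g, hgLip, hfg⟩ :=
    ((convex_Ioo a b).lipschitzOnWith_of_nnnorm_deriv_le hf hbound).extend_real
  have hgc : Continuous g := hgLip.continuous
  have hg : ∀ t ∈ Ioo a b, HasDerivAt g (φ t) t := fun t ht =>
    (hf t ht).hasDerivAt.congr_of_eventuallyEq
      (hfg.symm.eventuallyEq_of_mem (isOpen_Ioo.mem_nhds ht))
  have hparts : ∀ x y e : ℝ, x ≤ y → Ioo x y ⊆ Ioo a b → IntervalIntegrable φ volume x y →
      ∫ t in x..y, (t - e) * φ t = (y - e) * g y - (x - e) * g x - ∫ t in x..y, g t := by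
    intro x y e hxy hsub hφ
    have h := integral_mul_deriv_eq_deriv_mul_of_hasDerivAt (a := x) (b := y)
      (u := fun t => t - e) (u' := fun _ => 1) (v := g) (v' := φ) (by fun_prop)
      hgc.continuousOn (fun t _ => (hasDerivAt_id t).sub_const e)
      (fun t ht => hg t (hsub (by simpa [hxy] using ht))) (by simp) hφ
    simpa only [one_mul] using h
  have hφ₁ : IntervalIntegrable φ volume a c := hint.mono_set (by
    rw [uIcc_of_le hac.le, uIcc_of_le hab.le]; exact Icc_subset_Icc_right hcb.le)
  have hφ₂ : IntervalIntegrable φ volume c b := hint.mono_set (by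
    rw [uIcc_of_le hcb.le, uIcc_of_le hab.le]; exact Icc_subset_Icc_left hac.le)
  have h₁ := hparts a c a hac.le (Ioo_subset_Ioo_right hcb.le) hφ₁
  have h₂ := hparts c b b hcb.le (Ioo_subset_Ioo_left hac.le) hφ₂
  have hsum := integral_add_adjacent_intervals (hgc.intervalIntegrable (μ := volume) a c)
    (hgc.intervalIntegrable c b)
  have hid : f c - 1 / (b - a) * ∫ u in a..b, f u
      = 1 / (b - a) * ((∫ t in a..c, (t - a) * φ t) + ∫ t in c..b, (t - b) * φ t) := by
    rw [integral_congr_Ioo_of_le hab.le hfg, hfg ⟨hac, hcb⟩, h₁, h₂, ← hsum]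
    field_simp
    ring
  have hmid : |φ c| ^ q ≤ (|φ a| ^ q + |φ b| ^ q) / 2 := by
    refine (hconv.le_chord hab ⟨hac.le, hcb.le⟩).trans_eq ?_
    rw [hc]
    field_simp
    ring
  have hle₁ := abs_integral_sub_endpoint_mul_le hac hpq (Or.inl rfl) hφ₁
    (hconv.subset (Icc_subset_Icc_right hcb.le) (convex_Icc _ _))
  have hle₂ := abs_integral_sub_endpoint_mul_le hcb hpq (Or.inr rfl) hφ₂
    (hconv.subset (Icc_subset_Icc_left hac.le) (convex_Icc _ _))
  have hca : c - a = (b - a) / 2 := by rw [hc]; ring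
  have hbc : b - c = (b - a) / 2 := by rw [hc]; ring
  rw [hca] at hle₁
  rw [hbc] at hle₂
  have hs₁ : (|φ a| ^ q + |φ c| ^ q) / 2 ≤ 1 / 4 * (3 * |φ a| ^ q + |φ b| ^ q) := by linarith
  have hs₂ : (|φ c| ^ q + |φ b| ^ q) / 2 ≤ 1 / 4 * (|φ a| ^ q + 3 * |φ b| ^ q) := by linarith
  have hr₁ := Real.rpow_le_rpow (by positivity) hs₁ (z := 1 / q) (by positivity)
  have hr₂ := Real.rpow_le_rpow (by positivity) hs₂ (z := 1 / q) (by positivity)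
  rw [Real.mul_rpow (by norm_num) (by positivity)] at hr₁ hr₂
  have hfour : (1 / 4 : ℝ) ^ (1 / q) = 1 / 4 * 4 ^ (1 / p) := by
    have hexp : 1 / q = 1 - 1 / p := by
      simp only [one_div]; linarith [hpq.inv_add_inv_eq_one]
    rw [hexp, Real.rpow_sub (by norm_num), Real.rpow_one, Real.div_rpow (by norm_num) (by norm_num),
      Real.one_rpow]
    field_simp
  rw [hfour] at hr₁ hr₂
  rw [← hc, hid, abs_mul, abs_of_pos (by positivity : 0 < 1 / (b - a)),
    div_eq_mul_one_div 4 (p + 1), Real.mul_rpow (by norm_num) (by positivity)]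
  calc _ ≤ 1 / (b - a) *
        (((b - a) / 2) ^ 2 * (1 / (p + 1)) ^ (1 / p)
            * (1 / 4 * 4 ^ (1 / p) * (3 * |φ a| ^ q + |φ b| ^ q) ^ (1 / q))
          + ((b - a) / 2) ^ 2 * (1 / (p + 1)) ^ (1 / p)
            * (1 / 4 * 4 ^ (1 / p) * (|φ a| ^ q + 3 * |φ b| ^ q) ^ (1 / q))) := by
        gcongr
        refine (abs_add_le _ _).trans (add_le_add ?_ ?_)
        · exact hle₁.trans (by gcongr)
        · exact hle₂.trans (by gcongr)
    _ = _ := by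
        field_simp
        ring
end

section
/- Let f : I ⊆ [0, ∞) → ℝ be differentiable on I°, a, b ∈ I with a < b, and f' integrable on [a, b]. Let s ∈ (0, 1], p > 1 and q with 1/p + 1/q = 1. If |f'|^q is s-convex in the second sense on [a, b], then |f((a+b)/2) − (1/(b−a)) ∫_a^b f(u) du| ≤ ((b−a)/4) · (1/(p+1))^{1/p} · { ( (|f'((a+b)/2)|^q + |f'(b)|^q)/(s+1) )^{1/q} + ( (|f'(a)|^q + |f'((a+b)/2)|^q)/(s+1) )^{1/q} }. -/
open Set MeasureTheory intervalIntegral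

/-- Integration by parts against `t` on `[0, 1]`; `h` need not be continuous at `0`. -/
lemma integral_id_mul_eq_sub_of_hasDerivAt {h h' : ℝ → ℝ}
    (hd : ∀ t ∈ Ioc (0 : ℝ) 1, HasDerivAt h (h' t) t)
    (hi : IntervalIntegrable h' volume 0 1) :
    ∫ t in (0 : ℝ)..1, t * h' t = h 1 - ∫ t in (0 : ℝ)..1, h t := by
  set H : ℝ → ℝ := fun t => h 1 + ∫ x in (1 : ℝ)..t, h' x with hH
  have hHh : ∀ t ∈ Ioc (0 : ℝ) 1, H t = h t := by
    intro t ht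
    have hsub : uIcc 1 t ⊆ Ioc (0 : ℝ) 1 := by
      rw [uIcc_of_ge ht.2]
      exact fun x hx => ⟨ht.1.trans_le hx.1, hx.2⟩
    have := integral_eq_sub_of_hasDerivAt (fun x hx => hd x (hsub hx))
      (hi.mono_set (by
        rw [uIcc_of_le zero_le_one]
        exact hsub.trans Ioc_subset_Icc_self))
    simp only [hH, this]
    ring
  have hHc : ContinuousOn H (Icc 0 1) := by
    have := continuousOn_primitive_interval' hi (right_mem_uIcc)
    rw [uIcc_of_le zero_le_one] at this
    exact continuousOn_const.add this
  have hHi : IntervalIntegrable H volume 0 1 :=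
    ContinuousOn.intervalIntegrable (by rwa [uIcc_of_le zero_le_one])
  have hti : IntervalIntegrable (fun t => t * h' t) volume 0 1 :=
    hi.continuousOn_mul continuousOn_id
  have hHint : ∫ t in (0 : ℝ)..1, H t = ∫ t in (0 : ℝ)..1, h t := by
    refine integral_congr_ae (.of_forall fun t ht => hHh t ?_)
    rwa [uIoc_of_le zero_le_one] at ht
  have key := integral_eq_sub_of_hasDerivAt_of_le (f := fun t => t * H t)
    (f' := fun t => H t + t * h' t) zero_le_one (continuousOn_id.mul hHc)
    (fun t ht => by
      have hev : H =ᶠ[nhds t] h := by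
        filter_upwards [Ioo_mem_nhds ht.1 ht.2] with x hx
        exact hHh x (Ioo_subset_Ioc_self hx)
      have h1 := (hd t (Ioo_subset_Ioc_self ht)).congr_of_eventuallyEq hev
      simpa using (hasDerivAt_id' t).fun_mul h1) (hHi.add hti)
  rw [integral_add hHi hti, hHint, hHh 1 (by simp)] at key
  linarith

lemma integral_rpow_mul_add_one_sub_rpow_mul {s : ℝ} (hs : 0 < s) (A B : ℝ) :
    IntervalIntegrable (fun t : ℝ => t ^ s * A + (1 - t) ^ s * B) volume 0 1 ∧
      ∫ t in (0 : ℝ)..1, (t ^ s * A + (1 - t) ^ s * B) = (A + B) / (s + 1) := by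
  have hc : Continuous fun t : ℝ => t ^ s := Real.continuous_rpow_const hs.le
  have hc' : Continuous fun t : ℝ => (1 - t) ^ s := hc.comp (continuous_const.sub continuous_id)
  have h1 : ∫ t in (0 : ℝ)..1, t ^ s = 1 / (s + 1) := by
    rw [integral_rpow (Or.inl (by linarith)), Real.one_rpow, Real.zero_rpow (by linarith)]
    simp
  have h2 : ∫ t in (0 : ℝ)..1, (1 - t) ^ s = 1 / (s + 1) := by
    rw [integral_comp_sub_left (fun t : ℝ => t ^ s) 1]
    simpa using h1
  refine ⟨(by fun_prop : Continuous _).intervalIntegrable _ _, ?_⟩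
  rw [integral_add ((hc.fun_mul continuous_const).intervalIntegrable _ _)
    ((hc'.fun_mul continuous_const).intervalIntegrable _ _), intervalIntegral.integral_mul_const,
    intervalIntegral.integral_mul_const,
    h1, h2]
  ring

lemma abs_le_rpow_of_abs_rpow_le {s q x A B t : ℝ} (hs : 0 < s) (hq : 0 < q) (hA : 0 ≤ A)
    (hB : 0 ≤ B) (ht : t ∈ Icc (0 : ℝ) 1) (h : |x| ^ q ≤ t ^ s * A + (1 - t) ^ s * B) :
    |x| ≤ (A + B) ^ q⁻¹ := by
  rw [Real.le_rpow_inv_iff_of_pos (abs_nonneg _) (by positivity) hq]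
  have h1 := Real.rpow_le_one ht.1 ht.2 hs.le
  have h2 := Real.rpow_le_one (sub_nonneg.2 ht.2) (by linarith [ht.1]) hs.le
  nlinarith

/-- Hölder's inequality for `t ↦ t * g t` when `|g| ^ q` has an `s`-convex majorant. -/
lemma abs_integral_id_mul_le_of_abs_rpow_le {g : ℝ → ℝ} (hg : Measurable g) {s p q A B : ℝ}
    (hs : 0 < s) (hpq : p.HolderConjugate q) (hA : 0 ≤ A) (hB : 0 ≤ B)
    (h : ∀ t ∈ Icc (0 : ℝ) 1, |g t| ^ q ≤ t ^ s * A + (1 - t) ^ s * B) :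
    |∫ t in (0 : ℝ)..1, t * g t| ≤ (1 / (p + 1)) ^ (1 / p) * ((A + B) / (s + 1)) ^ (1 / q) := by
  have hp := hpq.pos
  have hq := hpq.symm.pos
  have hmem : ∀ᵐ t ∂volume.restrict (Ioc (0 : ℝ) 1), t ∈ Ioc (0 : ℝ) 1 :=
    ae_restrict_mem measurableSet_Ioc
  have hgL (r : ENNReal) : MemLp (fun t => |g t|) r (volume.restrict (Ioc (0 : ℝ) 1)) := by
    refine MemLp.of_bound hg.abs.aestronglyMeasurable ((A + B) ^ q⁻¹) ?_
    filter_upwards [hmem] with t ht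
    rw [Real.norm_eq_abs, abs_abs]
    exact abs_le_rpow_of_abs_rpow_le hs hq hA hB (Ioc_subset_Icc_self ht)
      (h t (Ioc_subset_Icc_self ht))
  have hidL : MemLp (fun t : ℝ => t) (ENNReal.ofReal p) (volume.restrict (Ioc (0 : ℝ) 1)) := by
    refine MemLp.of_bound measurable_id.aestronglyMeasurable 1 ?_
    filter_upwards [hmem] with t ht
    rw [Real.norm_eq_abs, abs_of_pos ht.1]
    exact ht.2
  have holder := integral_mul_le_Lp_mul_Lq_of_nonneg hpq
    (μ := volume.restrict (Ioc (0 : ℝ) 1)) (f := fun t => t) (g := fun t => |g t|)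
    (by filter_upwards [hmem] with t ht using ht.1.le) (.of_forall fun t => abs_nonneg _)
    hidL (hgL _)
  have hgi : Integrable (fun t => |g t| ^ q) (volume.restrict (Ioc (0 : ℝ) 1)) := by
    have := (hgL (ENNReal.ofReal q)).integrable_norm_rpow (by simpa using hq) (by simp)
    simpa [ENNReal.toReal_ofReal hq.le] using this
  have hq_int : ∫ t in Ioc (0 : ℝ) 1, |g t| ^ q ≤ (A + B) / (s + 1) := by
    obtain ⟨hi, he⟩ := integral_rpow_mul_add_one_sub_rpow_mul hs A B
    rw [← he, integral_of_le zero_le_one]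
    refine setIntegral_mono_on hgi ?_ measurableSet_Ioc
      fun t ht => h t (Ioc_subset_Icc_self ht)
    exact (intervalIntegrable_iff_integrableOn_Ioc_of_le zero_le_one).1 hi
  have hp_int : ∫ t in Ioc (0 : ℝ) 1, t ^ p = 1 / (p + 1) := by
    rw [← integral_of_le zero_le_one, integral_rpow (Or.inl (by linarith)), Real.one_rpow,
      Real.zero_rpow (by linarith)]
    simp
  rw [hp_int] at holder
  calc |∫ t in (0 : ℝ)..1, t * g t| ≤ ∫ t in (0 : ℝ)..1, |t * g t| :=
        abs_integral_le_integral_abs zero_le_one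
    _ = ∫ t in Ioc (0 : ℝ) 1, t * |g t| := by
        rw [integral_of_le zero_le_one]
        refine setIntegral_congr_fun measurableSet_Ioc fun t ht => ?_
        simp [abs_mul, abs_of_pos ht.1]
    _ ≤ _ := holder.trans (by gcongr)

lemma intervalIntegrable_of_intervalIntegrable_deriv {f : ℝ → ℝ} {a b : ℝ} (hab : a < b)
    (hd : ∀ x ∈ Ioo a b, DifferentiableAt ℝ f x) (hi : IntervalIntegrable (deriv f) volume a b) :
    IntervalIntegrable f volume a b := by
  obtain ⟨m, hm⟩ := nonempty_Ioo.2 hab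
  have hc : ContinuousOn (fun x => f m + ∫ y in m..x, deriv f y) (uIcc a b) :=
    continuousOn_const.add (continuousOn_primitive_interval' hi
      (by rw [uIcc_of_le hab.le]; exact Ioo_subset_Icc_self hm))
  have hF := hc.intervalIntegrable (μ := volume)
  rw [intervalIntegrable_iff_integrableOn_Ioo_of_le hab.le] at hF ⊢
  refine hF.congr_fun (fun x hx => ?_) measurableSet_Ioo
  have hsub : uIcc m x ⊆ Ioo a b := ordConnected_Ioo.uIcc_subset hm hx
  simp only
  rw [integral_deriv_eq_sub (fun y hy => hd y (hsub hy)) (hi.mono_set (by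
    rw [uIcc_of_le hab.le]
    exact hsub.trans Ioo_subset_Icc_self))]
  ring

/-- A one-sided midpoint-type estimate on the segment from `c` to `m`, in either direction. -/
lemma abs_sub_integral_div_le_of_abs_deriv_rpow_le {f : ℝ → ℝ} {m c s p q : ℝ} (hmc : m ≠ c)
    (hs : 0 < s) (hpq : p.HolderConjugate q)
    (hd : ∀ t ∈ Ioc (0 : ℝ) 1, DifferentiableAt ℝ f (t * m + (1 - t) * c))
    (h : ∀ t ∈ Icc (0 : ℝ) 1, |deriv f (t * m + (1 - t) * c)| ^ q
      ≤ t ^ s * |deriv f m| ^ q + (1 - t) ^ s * |deriv f c| ^ q) :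
    |f m - (∫ u in c..m, f u) / (m - c)| ≤ |m - c| *
      ((1 / (p + 1)) ^ (1 / p) *
        ((|deriv f m| ^ q + |deriv f c| ^ q) / (s + 1)) ^ (1 / q)) := by
  set g : ℝ → ℝ := fun t => deriv f (t * m + (1 - t) * c) with hg
  have hgm : Measurable g := (measurable_deriv f).comp (by fun_prop)
  have hgi : IntervalIntegrable (fun t => (m - c) * g t) volume 0 1 := by
    refine IntervalIntegrable.const_mul ?_ _
    rw [intervalIntegrable_iff_integrableOn_Ioc_of_le zero_le_one]
    refine Measure.integrableOn_of_bounded (M := (|deriv f m| ^ q + |deriv f c| ^ q) ^ q⁻¹)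
      (by simp) hgm.aestronglyMeasurable ?_
    filter_upwards [ae_restrict_mem measurableSet_Ioc] with t ht
    exact abs_le_rpow_of_abs_rpow_le hs hpq.symm.pos (by positivity) (by positivity)
      (Ioc_subset_Icc_self ht) (h t (Ioc_subset_Icc_self ht))
  have hparts := integral_id_mul_eq_sub_of_hasDerivAt
    (h := fun t => f (t * m + (1 - t) * c)) (fun t ht => by
      have hl : HasDerivAt (fun t : ℝ => t * m + (1 - t) * c) (m - c) t := by
        have := ((hasDerivAt_id' t).mul_const m).fun_add
          (((hasDerivAt_id' t).const_sub 1).mul_const c)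
        exact this.congr_deriv (by ring)
      have := (hd t ht).hasDerivAt.comp t hl
      rwa [mul_comm] at this) hgi
  have hcv : ∫ t in (0 : ℝ)..1, f (t * m + (1 - t) * c) = (∫ u in c..m, f u) / (m - c) := by
    have := integral_comp_mul_add (a := 0) (b := 1) f (sub_ne_zero.2 hmc) c
    simp only [mul_zero, zero_add, mul_one, sub_add_cancel, smul_eq_mul] at this
    rw [div_eq_inv_mul, ← this]
    refine integral_congr fun t _ => congrArg f ?_
    ring
  have hcm : ∫ t in (0 : ℝ)..1, t * ((m - c) * g t) = (m - c) * ∫ t in (0 : ℝ)..1, t * g t := by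
    rw [← intervalIntegral.integral_const_mul]
    congr with t
    ring
  rw [hcv, hcm] at hparts
  simp only [one_mul, sub_self, zero_mul, add_zero] at hparts
  rw [← hparts, abs_mul]
  gcongr
  exact abs_integral_id_mul_le_of_abs_rpow_le hgm hs hpq (by positivity) (by positivity) h

/-- Corollary 2.5: midpoint inequality when `|f'|^q` is `s`-convex in the second sense. -/
theorem midpoint_sconvex_pow_deriv
    (f : ℝ → ℝ) (I : Set ℝ) (hI : Convex ℝ I) (hI0 : I ⊆ Ici (0:ℝ))
    (a b : ℝ) (ha : a ∈ I) (hb : b ∈ I) (hab : a < b)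
    (hdiff : DifferentiableOn ℝ f (interior I))
    (hint : IntervalIntegrable (deriv f) volume a b)
    (s : ℝ) (hs : s ∈ Ioc (0:ℝ) 1)
    (p q : ℝ) (hp : 1 < p) (hpq : 1 / p + 1 / q = 1)
    (hconv : ∀ u ∈ Icc a b, ∀ v ∈ Icc a b, ∀ α ∈ Icc (0:ℝ) 1,
      |deriv f (α * u + (1 - α) * v)| ^ q
        ≤ α ^ s * |deriv f u| ^ q + (1 - α) ^ s * |deriv f v| ^ q) :
    |f ((a + b) / 2) - (1 / (b - a)) * ∫ u in a..b, f u|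
      ≤ (b - a) / 4 * (1 / (p + 1)) ^ (1 / p) *
        (((|deriv f ((a + b) / 2)| ^ q + |deriv f b| ^ q) / (s + 1)) ^ (1 / q)
          + ((|deriv f a| ^ q + |deriv f ((a + b) / 2)| ^ q) / (s + 1)) ^ (1 / q)) := by
  have hpq' : p.HolderConjugate q :=
    Real.holderConjugate_iff.2 ⟨hp, by simpa only [one_div] using hpq⟩
  have hIoo : Ioo a b ⊆ interior I :=
    interior_maximal (Ioo_subset_Icc_self.trans (hI.ordConnected.out ha hb)) isOpen_Ioo
  have hd : ∀ x ∈ Ioo a b, DifferentiableAt ℝ f x := fun x hx =>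
    hdiff.differentiableAt (isOpen_interior.mem_nhds (hIoo hx))
  set m := (a + b) / 2 with hm
  have hma : m - a = (b - a) / 2 := by rw [hm]; ring
  have hmb : m - b = -((b - a) / 2) := by rw [hm]; ring
  have ham : a < m := by linarith
  have hbm : m < b := by linarith
  have hmI : m ∈ Icc a b := ⟨ham.le, hbm.le⟩
  have h1 := abs_sub_integral_div_le_of_abs_deriv_rpow_le ham.ne' hs.1 hpq'
    (fun t ht => hd _ ⟨by nlinarith [ht.1, ht.2], by nlinarith [ht.1, ht.2]⟩)
    (hconv m hmI a (left_mem_Icc.2 hab.le))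
  have h2 := abs_sub_integral_div_le_of_abs_deriv_rpow_le hbm.ne hs.1 hpq'
    (fun t ht => hd _ ⟨by nlinarith [ht.1, ht.2], by nlinarith [ht.1, ht.2]⟩)
    (hconv m hmI b (right_mem_Icc.2 hab.le))
  have hfi := intervalIntegrable_of_intervalIntegrable_deriv hab hd hint
  have hmu : m ∈ uIcc a b := by rwa [uIcc_of_le hab.le]
  have hsplit := integral_add_adjacent_intervals
    (hfi.mono_set (uIcc_subset_uIcc left_mem_uIcc hmu))
    (hfi.mono_set (uIcc_subset_uIcc hmu right_mem_uIcc))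
  have hba : b - a ≠ 0 := (sub_pos.2 hab).ne'
  have heq : f m - 1 / (b - a) * ∫ u in a..b, f u =
      ((f m - (∫ u in a..m, f u) / (m - a)) + (f m - (∫ u in b..m, f u) / (m - b))) / 2 := by
    rw [← hsplit, integral_symm m b, hma, hmb]
    field_simp
    ring
  have hma' : |m - a| = (b - a) / 2 := by rw [hma, abs_of_pos (by linarith)]
  have hmb' : |m - b| = (b - a) / 2 := by rw [hmb, abs_neg, abs_of_pos (by linarith)]
  rw [hma'] at h1
  rw [hmb'] at h2
  rw [heq, abs_div, abs_two, div_le_iff₀ two_pos, add_comm (|deriv f a| ^ q)]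
  refine (abs_add_le _ _).trans ((add_le_add h1 h2).trans_eq ?_)
  ring
end

section
/- Let f : I ⊆ [0, ∞) → ℝ be differentiable on I°, a, b ∈ I with a < b, and f' integrable on [a, b]. If |f'|^2 is convex on [a, b], then |f((a+b)/2) − (1/(b−a)) ∫_a^b f(u) du| ≤ ((b−a)/2) · ( (|f'(a)|^2 + |f'(b)|^2)/6 )^{1/2}. -/
open Set MeasureTheory intervalIntegral

/-- A function with integrable derivative on `(a, b)` agrees there with a function that is
continuous on `[a, b]`. -/
theorem exists_continuousOn_Icc_eqOn_Ioo {f : ℝ → ℝ} {a b : ℝ} (hab : a < b)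
    (hf : ∀ x ∈ Ioo a b, HasDerivAt f (deriv f x) x)
    (hint : IntervalIntegrable (deriv f) volume a b) :
    ∃ G : ℝ → ℝ, ContinuousOn G (Icc a b) ∧ EqOn G f (Ioo a b) := by
  have hm : (a + b) / 2 ∈ Ioo a b := ⟨by linarith, by linarith⟩
  have hmI : (a + b) / 2 ∈ uIcc a b := by
    rw [uIcc_of_le hab.le]; exact Ioo_subset_Icc_self hm
  refine ⟨fun t => f ((a + b) / 2) + ∫ x in ((a + b) / 2)..t, deriv f x, ?_, fun t ht => ?_⟩
  · have h := continuousOn_primitive_interval' hint hmI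
    rw [uIcc_of_le hab.le] at h
    exact continuousOn_const.add h
  · have hsub : uIcc ((a + b) / 2) t ⊆ Ioo a b := ordConnected_Ioo.uIcc_subset hm ht
    have h := integral_eq_sub_of_hasDerivAt (fun x hx => hf x (hsub hx))
      (hint.mono_set (hsub.trans (by rw [uIcc_of_le hab.le]; exact Ioo_subset_Icc_self)))
    simp only [h]
    ring

/-- Integration by parts against `t - e`, when the function has only an integrable
derivative in the interior of the interval. -/
theorem integral_sub_const_mul_deriv {f f' : ℝ → ℝ} {c d : ℝ} (e : ℝ) (hcd : c ≤ d)
    (hcont : ContinuousOn f (Icc c d)) (hf : ∀ x ∈ Ioo c d, HasDerivAt f (f' x) x)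
    (hint : IntervalIntegrable f' volume c d) :
    ∫ t in c..d, (t - e) * f' t = (d - e) * f d - (c - e) * f c - ∫ t in c..d, f t := by
  have h := integral_mul_deriv_eq_deriv_mul_of_hasDerivAt (a := c) (b := d)
    (u := fun t => t - e) (u' := fun _ => 1) (v := f) (v' := f')
    (by fun_prop) (by rwa [uIcc_of_le hcd])
    (fun x _ => (hasDerivAt_id x).sub_const e)
    (by rwa [min_eq_left hcd, max_eq_right hcd]) (by simp) hint
  simpa using h

/-- The difference between the midpoint value and the mean, as integrals of the derivative
against the Peano kernel. -/
theorem midpoint_sub_integral_eq {f : ℝ → ℝ} {a b : ℝ} (hab : a < b)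
    (hf : ∀ x ∈ Ioo a b, HasDerivAt f (deriv f x) x)
    (hint : IntervalIntegrable (deriv f) volume a b) :
    (b - a) * f ((a + b) / 2) - ∫ u in a..b, f u =
      (∫ t in a..((a + b) / 2), (t - a) * deriv f t) +
        ∫ t in ((a + b) / 2)..b, (t - b) * deriv f t := by
  obtain ⟨G, hG, hGf⟩ := exists_continuousOn_Icc_eqOn_Ioo hab hf hint
  have hG' : ∀ x ∈ Ioo a b, HasDerivAt G (deriv f x) x := fun x hx =>
    (hf x hx).congr_of_eventuallyEq (hGf.eventuallyEq_of_mem (Ioo_mem_nhds hx.1 hx.2))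
  have ham : a < (a + b) / 2 := by linarith
  have hmb : (a + b) / 2 < b := by linarith
  have hl : Icc a ((a + b) / 2) ⊆ Icc a b := Icc_subset_Icc_right hmb.le
  have hr : Icc ((a + b) / 2) b ⊆ Icc a b := Icc_subset_Icc_left ham.le
  have hGl := hG.mono hl
  have hGr := hG.mono hr
  rw [← uIcc_of_le hab.le] at hl hr
  rw [← uIcc_of_le ham.le] at hl
  rw [← uIcc_of_le hmb.le] at hr
  rw [integral_sub_const_mul_deriv a ham.le hGl
      (fun x hx => hG' x ⟨hx.1, hx.2.trans hmb⟩) (hint.mono_set hl),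
    integral_sub_const_mul_deriv b hmb.le hGr
      (fun x hx => hG' x ⟨ham.trans hx.1, hx.2⟩) (hint.mono_set hr),
    ← integral_congr_Ioo_of_le hab.le hGf, ← hGf ⟨ham, hmb⟩,
    ← integral_add_adjacent_intervals (hGl.intervalIntegrable_of_Icc ham.le)
      (hGr.intervalIntegrable_of_Icc hmb.le)]
  ring

/-- If `g ^ 2` lies below an affine function, the integral of `(t - e) * g` is bounded through
`2 x y ≤ x ^ 2 + y ^ 2`. -/
theorem integral_sub_const_mul_le {g : ℝ → ℝ} {c d : ℝ} (a e p q l : ℝ) (hcd : c ≤ d)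
    (hint : IntervalIntegrable g volume c d)
    (hg : ∀ t ∈ Icc c d, g t ^ 2 ≤ p * (t - a) + q) :
    2 * l * ∫ t in c..d, (t - e) * g t ≤
      (l ^ 2 * (d - e) ^ 3 / 3 + p * (d - a) ^ 2 / 2 + q * (d - a)) -
        (l ^ 2 * (c - e) ^ 3 / 3 + p * (c - a) ^ 2 / 2 + q * (c - a)) := by
  have hpoly : IntervalIntegrable (fun t => l ^ 2 * (t - e) ^ 2 + (p * (t - a) + q)) volume c d :=
    Continuous.intervalIntegrable (by fun_prop) _ _
  have hderiv : ∀ x ∈ uIcc c d, HasDerivAt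
      (fun t => l ^ 2 * (t - e) ^ 3 / 3 + p * (t - a) ^ 2 / 2 + q * (t - a))
      (l ^ 2 * (x - e) ^ 2 + (p * (x - a) + q)) x := by
    intro x _
    have he := (hasDerivAt_id x).sub_const e
    have ha := (hasDerivAt_id x).sub_const a
    refine (((((he.pow 3).const_mul (l ^ 2)).div_const 3).add
      (((ha.pow 2).const_mul p).div_const 2)).add (ha.const_mul q)).congr_deriv ?_
    simp only [id]
    push_cast
    ring
  rw [← integral_eq_sub_of_hasDerivAt hderiv hpoly, ← intervalIntegral.integral_const_mul]
  refine integral_mono_on hcd ?_ hpoly fun t ht => ?_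
  · exact (hint.continuousOn_mul (by fun_prop)).const_mul _
  · nlinarith [hg t ht, sq_nonneg (l * (t - e) - g t)]

/-- Corollary 2.9: midpoint inequality when `|f'|^2` is convex on `[a, b]`. -/
theorem midpoint_convex_sq_deriv
    (f : ℝ → ℝ) (I : Set ℝ) (hI : Convex ℝ I) (hI0 : I ⊆ Ici (0:ℝ))
    (a b : ℝ) (ha : a ∈ I) (hb : b ∈ I) (hab : a < b)
    (hdiff : DifferentiableOn ℝ f (interior I))
    (hint : IntervalIntegrable (deriv f) volume a b)
    (hconv : ConvexOn ℝ (Icc a b) (fun t => |deriv f t| ^ 2)) :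
    |f ((a + b) / 2) - (1 / (b - a)) * ∫ u in a..b, f u|
      ≤ (b - a) / 2 * ((|deriv f a| ^ 2 + |deriv f b| ^ 2) / 6) ^ ((1:ℝ) / 2) := by
  have hsub : Ioo a b ⊆ interior I :=
    interior_maximal (Ioo_subset_Icc_self.trans (hI.ordConnected.out ha hb)) isOpen_Ioo
  have hf : ∀ x ∈ Ioo a b, HasDerivAt f (deriv f x) x := fun x hx =>
    (hdiff.differentiableAt (isOpen_interior.mem_nhds (hsub hx))).hasDerivAt
  have hd : 0 < b - a := sub_pos.2 hab
  have hchord : ∀ t ∈ Icc a b, deriv f t ^ 2 ≤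
      (deriv f b ^ 2 - deriv f a ^ 2) / (b - a) * (t - a) + deriv f a ^ 2 := by
    intro t ht
    have h := hconv.2 (left_mem_Icc.2 hab.le) (right_mem_Icc.2 hab.le)
      (div_nonneg (sub_nonneg.2 ht.2) hd.le) (div_nonneg (sub_nonneg.2 ht.1) hd.le)
      (by field_simp; ring)
    have ht' : ((b - t) / (b - a)) • a + ((t - a) / (b - a)) • b = t := by
      simp only [smul_eq_mul]; field_simp; ring
    simp only [ht', sq_abs] at h
    simp only [smul_eq_mul] at h
    refine h.trans_eq ?_
    field_simp
    ring
  have ham : a ≤ (a + b) / 2 := by linarith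
  have hmb : (a + b) / 2 ≤ b := by linarith
  set D := f ((a + b) / 2) - (1 / (b - a)) * ∫ u in a..b, f u with hD
  have hrep : (b - a) * D = _ :=
    Eq.trans (by rw [hD]; field_simp) (midpoint_sub_integral_eq hab hf hint)
  have hquad : ∀ l : ℝ, 2 * l * ((b - a) * D) ≤
      l ^ 2 * (b - a) ^ 3 / 12 + (deriv f a ^ 2 + deriv f b ^ 2) / 2 * (b - a) := by
    intro l
    have h₁ := integral_sub_const_mul_le a a _ _ l ham
      (hint.mono_set (by
        rw [uIcc_of_le ham, uIcc_of_le hab.le]; exact Icc_subset_Icc_right hmb))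
      (fun t ht => hchord t ⟨ht.1, ht.2.trans hmb⟩)
    have h₂ := integral_sub_const_mul_le a b _ _ l hmb
      (hint.mono_set (by
        rw [uIcc_of_le hmb, uIcc_of_le hab.le]; exact Icc_subset_Icc_left ham))
      (fun t ht => hchord t ⟨ham.trans ht.1, ht.2⟩)
    rw [hrep, mul_add]
    refine (add_le_add h₁ h₂).trans_eq ?_
    field_simp
    ring
  have hsq : D ^ 2 ≤ ((b - a) / 2) ^ 2 * ((deriv f a ^ 2 + deriv f b ^ 2) / 6) := by
    have h := hquad (12 * D / (b - a) ^ 2)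
    have h' : 24 * D ^ 2 / (b - a) ≤
        12 * D ^ 2 / (b - a) + (deriv f a ^ 2 + deriv f b ^ 2) / 2 * (b - a) := by
      convert h using 1
      · field_simp; ring
      · field_simp
    field_simp at h'
    nlinarith
  rw [sq_abs, sq_abs, ← Real.sqrt_eq_rpow]
  refine abs_le_of_sq_le_sq ?_ (by positivity)
  rwa [mul_pow, Real.sq_sqrt (by positivity)]
end

section
/- Let 0 < a < b and s ∈ (0, 1). Then |A^s(a, b) − L_s^s(a, b)| ≤ (b−a) · (s/((s+1)(s+2))) · (1 − 1/2^{s+1}) · [a^{s−1} + b^{s−1}]. -/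
open MeasureTheory

/-- The trapezoid rule underestimates the integral of a continuous concave function. -/
theorem ConcaveOn.trapezoid_le_integral {f : ℝ → ℝ} {a b : ℝ} (hab : a < b)
    (hf : ConcaveOn ℝ (Set.Icc a b) f) (hc : ContinuousOn f (Set.Icc a b)) :
    (b - a) * ((f a + f b) / 2) ≤ ∫ x in a..b, f x := by
  have hba : 0 < b - a := sub_pos.2 hab
  have hline : ∫ x in a..b, (f a + (f b - f a) / (b - a) * (x - a))
      = (b - a) * ((f a + f b) / 2) := by
    rw [intervalIntegral.integral_add (by simp)
      ((by fun_prop : Continuous _).intervalIntegrable _ _)]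
    simp only [intervalIntegral.integral_const, intervalIntegral.integral_const_mul,
      intervalIntegral.integral_comp_sub_right (fun x => x), integral_id, smul_eq_mul]
    field_simp
    ring
  rw [← hline]
  refine intervalIntegral.integral_mono_on hab.le
    ((by fun_prop : Continuous _).intervalIntegrable _ _)
    (hc.intervalIntegrable_of_Icc hab.le) fun x hx => ?_
  have h := hf.2 (Set.left_mem_Icc.2 hab.le) (Set.right_mem_Icc.2 hab.le)
    (div_nonneg (sub_nonneg.2 hx.2) hba.le) (div_nonneg (sub_nonneg.2 hx.1) hba.le)
    (by field_simp; ring)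
  simp only [smul_eq_mul] at h
  have hcomb : (b - x) / (b - a) * a + (x - a) / (b - a) * b = x := by field_simp; ring
  rw [hcomb] at h
  refine le_of_eq_of_le ?_ h
  field_simp
  ring

/-- The midpoint rule overestimates the integral of a continuous concave function. -/
theorem ConcaveOn.integral_le_midpoint {f : ℝ → ℝ} {a b : ℝ} (hab : a ≤ b)
    (hf : ConcaveOn ℝ (Set.Icc a b) f) (hc : ContinuousOn f (Set.Icc a b)) :
    ∫ x in a..b, f x ≤ (b - a) * f ((a + b) / 2) := by
  have hint := hc.intervalIntegrable_of_Icc (μ := volume) hab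
  have hmem : ∀ x ∈ Set.Icc a b, a + b - x ∈ Set.Icc a b := fun x hx =>
    ⟨by linarith [hx.2], by linarith [hx.1]⟩
  have hint' : IntervalIntegrable (fun x => f (a + b - x)) volume a b :=
    (hc.comp (by fun_prop) hmem).intervalIntegrable_of_Icc hab
  have hrefl : ∫ x in a..b, f (a + b - x) = ∫ x in a..b, f x := by
    simp [intervalIntegral.integral_comp_sub_left f]
  have hle : ∫ x in a..b, (f x + f (a + b - x)) ≤ ∫ _x in a..b, 2 * f ((a + b) / 2) := by
    refine intervalIntegral.integral_mono_on hab (hint.add hint') (by simp) fun x hx => ?_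
    have h := hf.2 hx (hmem x hx) (one_half_pos (α := ℝ)).le (one_half_pos (α := ℝ)).le
      (by norm_num)
    simp only [smul_eq_mul] at h
    rw [show 1 / 2 * x + 1 / 2 * (a + b - x) = (a + b) / 2 by ring] at h
    linarith
  rw [intervalIntegral.integral_add hint hint', hrefl, intervalIntegral.integral_const,
    smul_eq_mul] at hle
  linarith

/-- The graph of `x ↦ x ^ s` lies below its tangent lines when `0 ≤ s ≤ 1`. -/
theorem Real.rpow_le_tangent {s x y : ℝ} (hs₀ : 0 ≤ s) (hs₁ : s ≤ 1) (hx : 0 < x)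
    (hy : 0 ≤ y) : y ^ s ≤ x ^ s + s * x ^ (s - 1) * (y - x) := by
  have h := rpow_one_add_le_one_add_mul_self (s := y / x - 1)
    (by linarith [div_nonneg hy hx.le]) hs₀ hs₁
  rw [add_sub_cancel, Real.div_rpow hy hx.le, div_le_iff₀ (Real.rpow_pos_of_pos hx s)] at h
  refine h.trans_eq ?_
  rw [Real.rpow_sub_one hx.ne']
  field_simp

/-- The constant of the midpoint inequality for `s`-convex derivatives is at least the
constant `1 / 8` for convex ones. -/
theorem one_eighth_le_midpoint_const {s : ℝ} (hs₀ : 0 ≤ s) (hs₁ : s ≤ 1) :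
    1 / 8 ≤ 1 / ((s + 1) * (s + 2)) * (1 - 1 / 2 ^ (s + 1)) := by
  have h : (1 / 2 : ℝ) ^ s ≤ 1 - s / 2 := by
    have := rpow_one_add_le_one_add_mul_self (s := -1 / 2) (by norm_num) hs₀ hs₁
    norm_num at this ⊢
    linarith
  have h2 : (1 : ℝ) / 2 ^ (s + 1) = (1 / 2) ^ s / 2 := by
    rw [Real.rpow_add_one two_ne_zero, Real.div_rpow zero_le_one zero_le_two, Real.one_rpow]
    field_simp
  rw [h2, one_div_mul_eq_div, le_div_iff₀ (by positivity)]
  nlinarith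

/-- Proposition 3.1: inequality between the arithmetic mean and the `s`-logarithmic
mean.  Here `A(a,b) = (a+b)/2` and `L_s^s(a,b) = (b^{s+1} − a^{s+1})/((s+1)(b−a))`. -/
theorem means_sconvex_midpoint
    (a b s : ℝ) (ha : 0 < a) (hab : a < b) (hs : s ∈ Set.Ioo (0:ℝ) 1) :
    |((a + b) / 2) ^ s - (b ^ (s + 1) - a ^ (s + 1)) / ((s + 1) * (b - a))|
      ≤ (b - a) * (s / ((s + 1) * (s + 2))) * (1 - 1 / 2 ^ (s + 1)) *
        (a ^ (s - 1) + b ^ (s - 1)) := by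
  obtain ⟨hs₀, hs₁⟩ := hs
  have hb : 0 < b := ha.trans hab
  have hba : 0 < b - a := sub_pos.2 hab
  set m := (a + b) / 2 with hm
  have ham : a < m := by linarith
  have hmb : m < b := by linarith
  have hm₀ : 0 < m := ha.trans ham
  have hconc : ∀ {u v : ℝ}, 0 < u → ConcaveOn ℝ (Set.Icc u v) (fun x : ℝ => x ^ s) :=
    fun hu => (Real.concaveOn_rpow hs₀.le hs₁.le).subset
      (fun x hx => hu.le.trans hx.1) (convex_Icc _ _)
  have hcont : Continuous fun x : ℝ => x ^ s := Real.continuous_rpow_const hs₀.le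
  have hint : ∀ u v : ℝ, ∫ x in u..v, x ^ s = (v ^ (s + 1) - u ^ (s + 1)) / (s + 1) :=
    fun u v => integral_rpow (Or.inl (by linarith))
  have hup := (hconc ha).integral_le_midpoint hab.le hcont.continuousOn
  have hlow₁ := (hconc ha).trapezoid_le_integral ham hcont.continuousOn
  have hlow₂ := (hconc hm₀).trapezoid_le_integral hmb hcont.continuousOn
  have hadd := intervalIntegral.integral_add_adjacent_intervals
    (hcont.intervalIntegrable (μ := volume) a m) (hcont.intervalIntegrable m b)
  simp only [← hm] at hup
  have hmean : (b ^ (s + 1) - a ^ (s + 1)) / ((s + 1) * (b - a))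
      = (∫ x in a..b, x ^ s) / (b - a) := by rw [hint, div_div]
  have hta := Real.rpow_le_tangent hs₀.le hs₁.le ha hm₀.le
  have htb := Real.rpow_le_tangent hs₀.le hs₁.le hb hm₀.le
  have hpa := Real.rpow_pos_of_pos ha (s - 1)
  have hpb := Real.rpow_pos_of_pos hb (s - 1)
  have hma : m - a = (b - a) / 2 := by rw [hm]; ring
  have hbm : b - m = (b - a) / 2 := by rw [hm]; ring
  rw [hma] at hta hlow₁
  rw [← neg_sub b m, hbm] at htb
  rw [hbm] at hlow₂
  have hmid : (∫ x in a..b, x ^ s) / (b - a) ≤ m ^ s := by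
    rw [div_le_iff₀ hba]; linarith
  have htrap : m ^ s / 2 + (a ^ s + b ^ s) / 4 ≤ (∫ x in a..b, x ^ s) / (b - a) := by
    rw [le_div_iff₀ hba]; linarith
  have hpos : 0 ≤ (b - a) * s * b ^ (s - 1) := by positivity
  rw [hmean, abs_of_nonneg (sub_nonneg.2 hmid)]
  calc m ^ s - (∫ x in a..b, x ^ s) / (b - a)
      ≤ (1 / 8) * ((b - a) * s * (a ^ (s - 1) + b ^ (s - 1))) := by linarith
    _ ≤ 1 / ((s + 1) * (s + 2)) * (1 - 1 / 2 ^ (s + 1)) *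
          ((b - a) * s * (a ^ (s - 1) + b ^ (s - 1))) :=
        mul_le_mul_of_nonneg_right (one_eighth_le_midpoint_const hs₀.le hs₁.le)
          (by positivity)
    _ = _ := by ring
end

section
/- Let 0 < a < b, s ∈ (0, 1), and let p > 1, q with 1/p + 1/q = 1. Then |A^s(a, b) − L_s^s(a, b)| ≤ s · ((b−a)/4) · (1/(p+1))^{1/p} · [ ( (A(a,b)^{q(s−1)} + b^{q(s−1)})/(s+1) )^{1/q} + ( (a^{q(s−1)} + A(a,b)^{q(s−1)})/(s+1) )^{1/q} ]. -/
open intervalIntegral in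
/-- The upper Hermite–Hadamard inequality. -/
theorem ConvexOn.integral_le_trapezoid {f : ℝ → ℝ} {a b : ℝ} (hab : a ≤ b)
    (hf : ConvexOn ℝ (Set.Icc a b) f) (hc : ContinuousOn f (Set.Icc a b)) :
    ∫ x in a..b, f x ≤ (b - a) * ((f a + f b) / 2) := by
  rcases hab.eq_or_lt with rfl | hlt
  · simp
  have hi : IntervalIntegrable f MeasureTheory.volume a b :=
    ContinuousOn.intervalIntegrable_of_Icc hab hc
  have hchord : ∫ x in a..b, (f a + (f b - f a) / (b - a) * (x - a))
      = (b - a) * ((f a + f b) / 2) := by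
    have hne : b - a ≠ 0 := (sub_pos.2 hlt).ne'
    rw [integral_add (by simp) (Continuous.intervalIntegrable (by fun_prop) _ _),
      integral_const_mul, integral_sub (by simp) (by simp)]
    simp only [integral_const, integral_id, smul_eq_mul]
    field_simp
    ring
  rw [← hchord]
  refine integral_mono_on hab hi (Continuous.intervalIntegrable (by fun_prop) _ _) fun x hx ↦ ?_
  have hba : 0 < b - a := sub_pos.2 hlt
  have h := hf.2 (Set.left_mem_Icc.2 hab) (Set.right_mem_Icc.2 hab)
    (div_nonneg (sub_nonneg.2 hx.2) hba.le) (div_nonneg (sub_nonneg.2 hx.1) hba.le)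
    (by field_simp; ring)
  simp only [smul_eq_mul] at h
  have hxe : (b - x) / (b - a) * a + (x - a) / (b - a) * b = x := by field_simp; ring
  rw [hxe] at h
  refine h.trans_eq ?_
  field_simp
  ring

open intervalIntegral in
/-- The lower Hermite–Hadamard inequality. -/
theorem ConvexOn.midpoint_le_integral {f : ℝ → ℝ} {a b : ℝ} (hab : a ≤ b)
    (hf : ConvexOn ℝ (Set.Icc a b) f) (hc : ContinuousOn f (Set.Icc a b)) :
    (b - a) * f ((a + b) / 2) ≤ ∫ x in a..b, f x := by
  have hi : IntervalIntegrable f MeasureTheory.volume a b :=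
    ContinuousOn.intervalIntegrable_of_Icc hab hc
  have hmaps : Set.MapsTo (fun x ↦ a + b - x) (Set.Icc a b) (Set.Icc a b) :=
    fun x hx ↦ ⟨by linarith [hx.2], by linarith [hx.1]⟩
  have hi' : IntervalIntegrable (fun x ↦ f (a + b - x)) MeasureTheory.volume a b :=
    ContinuousOn.intervalIntegrable_of_Icc hab (hc.comp (by fun_prop) hmaps)
  have hrefl : ∫ x in a..b, f (a + b - x) = ∫ x in a..b, f x := by simp
  have hmono : ∫ _ in a..b, 2 * f ((a + b) / 2) ≤ ∫ x in a..b, (f x + f (a + b - x)) := by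
    refine integral_mono_on hab (by simp) (hi.add hi') fun x hx ↦ ?_
    have h := hf.2 hx (hmaps hx) (by norm_num : (0 : ℝ) ≤ 1 / 2)
      (by norm_num : (0 : ℝ) ≤ 1 / 2) (by norm_num)
    simp only [smul_eq_mul] at h
    rw [show 1 / 2 * x + 1 / 2 * (a + b - x) = (a + b) / 2 by ring] at h
    linarith
  rw [integral_add hi hi', hrefl, integral_const, smul_eq_mul] at hmono
  linarith

theorem convexOn_rpow_of_nonpos {r : ℝ} (hr : r ≤ 0) :
    ConvexOn ℝ (Set.Ioi 0) fun x : ℝ ↦ x ^ r := by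
  refine ⟨convex_Ioi 0, fun x hx y hy u v hu hv huv ↦ ?_⟩
  have hx' : (0 : ℝ) < x := hx
  have hy' : (0 : ℝ) < y := hy
  have hxy : 0 < u • x + v • y := convex_Ioi (0 : ℝ) hx hy hu hv huv
  have hlog := strictConcaveOn_log_Ioi.concaveOn.2 hx hy hu hv huv
  have hexp := convexOn_exp.2 (Set.mem_univ (Real.log x * r)) (Set.mem_univ (Real.log y * r))
    hu hv huv
  simp only [Real.rpow_def_of_pos hx', Real.rpow_def_of_pos hy', Real.rpow_def_of_pos hxy]
  refine le_trans (Real.exp_le_exp.2 ?_) hexp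
  simp only [smul_eq_mul] at hlog ⊢
  nlinarith

theorem ContinuousOn.rpow_const_Icc_of_pos {a b : ℝ} (ha : 0 < a) (r : ℝ) :
    ContinuousOn (fun x : ℝ ↦ x ^ r) (Set.Icc a b) :=
  continuousOn_id.rpow_const fun _ hx ↦ Or.inl (ha.trans_le hx.1).ne'

/-- The power mean inequality with a normalising constant at most `2`. -/
theorem add_div_two_le_rpow_mean {u v q c : ℝ} (hu : 0 ≤ u) (hv : 0 ≤ v) (hq : 1 ≤ q)
    (hc : 0 < c) (hc2 : c ≤ 2) : (u + v) / 2 ≤ ((u ^ q + v ^ q) / c) ^ (1 / q) := by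
  have hq0 : 0 < q := by linarith
  have h := (convexOn_rpow hq).2 (Set.mem_Ici.2 hu) (Set.mem_Ici.2 hv)
    (by norm_num : (0 : ℝ) ≤ 1 / 2) (by norm_num : (0 : ℝ) ≤ 1 / 2) (by norm_num)
  simp only [smul_eq_mul] at h
  rw [show 1 / 2 * u + 1 / 2 * v = (u + v) / 2 by ring] at h
  rw [one_div, Real.le_rpow_inv_iff_of_pos (by positivity) (by positivity) hq0]
  calc ((u + v) / 2) ^ q ≤ (u ^ q + v ^ q) / 2 := by linarith
    _ ≤ (u ^ q + v ^ q) / c := by gcongr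

theorem half_le_one_div_add_one_rpow {p : ℝ} (hp : 1 ≤ p) :
    1 / 2 ≤ (1 / (p + 1)) ^ (1 / p) := by
  have hp0 : 0 < p := by linarith
  rw [one_div p, Real.le_rpow_inv_iff_of_pos (by positivity) (by positivity) hp0,
    Real.div_rpow zero_le_one zero_le_two, Real.one_rpow]
  have h := one_add_mul_self_le_rpow_one_add (by norm_num : (-1 : ℝ) ≤ 1) hp
  norm_num at h
  gcongr
  linarith

theorem rpow_sub_rpow_le_of_lt_one {x y s : ℝ} (hx : 0 < x) (hxy : x ≤ y) (hs : 0 < s)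
    (hs1 : s ≤ 1) :
    y ^ s - x ^ s ≤ s * ((y - x) * ((x ^ (s - 1) + y ^ (s - 1)) / 2)) := by
  have hconv : ConvexOn ℝ (Set.Icc x y) fun t : ℝ ↦ t ^ (s - 1) :=
    (convexOn_rpow_of_nonpos (by linarith)).subset
      (fun t ht ↦ hx.trans_le ht.1) (convex_Icc x y)
  have h := hconv.integral_le_trapezoid hxy (ContinuousOn.rpow_const_Icc_of_pos hx _)
  rwa [integral_rpow (Or.inl (by linarith)), sub_add_cancel, div_le_iff₀' hs] at h

/-- Proposition 3.2: inequality between the arithmetic mean and the `s`-logarithmic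
mean, with conjugate exponents `p, q`.  Here `A = A(a,b) = (a+b)/2` and
`L_s^s(a,b) = (b^{s+1} − a^{s+1})/((s+1)(b−a))`. -/
theorem means_sconvex_holder
    (a b s p q : ℝ) (ha : 0 < a) (hab : a < b) (hs : s ∈ Set.Ioo (0:ℝ) 1)
    (hp : 1 < p) (hpq : 1 / p + 1 / q = 1) :
    |((a + b) / 2) ^ s - (b ^ (s + 1) - a ^ (s + 1)) / ((s + 1) * (b - a))|
      ≤ s * ((b - a) / 4) * (1 / (p + 1)) ^ (1 / p) *
        (((((a + b) / 2) ^ (q * (s - 1)) + b ^ (q * (s - 1))) / (s + 1)) ^ (1 / q)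
          + ((a ^ (q * (s - 1)) + ((a + b) / 2) ^ (q * (s - 1))) / (s + 1)) ^ (1 / q)) := by
  obtain ⟨hs0, hs1⟩ := hs
  have hp0 : 0 < p := by linarith
  have hq : 1 < q := by
    have hq_inv : 1 / q = 1 - 1 / p := by linarith
    have hp_inv : 1 / p < 1 := by rw [div_lt_one hp0]; exact hp
    have hq_pos : 0 < q := one_div_pos.1 (by linarith)
    exact (one_div_lt_one_div hq_pos one_pos).1 (by linarith [one_div_pos.2 hp0])
  set m := (a + b) / 2 with hm
  have ham : a < m := by linarith
  have hmb : m < b := by linarith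
  have hm0 : 0 < m := ha.trans ham
  have hb0 : 0 < b := ha.trans hab
  have hba : 0 < b - a := sub_pos.2 hab
  have hconc {x y : ℝ} (hx : 0 < x) : ConvexOn ℝ (Set.Icc x y) (-fun t : ℝ ↦ t ^ s) :=
    ((Real.concaveOn_rpow hs0.le hs1.le).subset
      (fun t ht ↦ hx.le.trans ht.1) (convex_Icc x y)).neg
  have hcont {x y : ℝ} (hx : 0 < x) : ContinuousOn (-fun t : ℝ ↦ t ^ s) (Set.Icc x y) :=
    (ContinuousOn.rpow_const_Icc_of_pos hx s).neg
  have hint (x y : ℝ) : ∫ t in x..y, (-fun t : ℝ ↦ t ^ s) t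
      = -((y ^ (s + 1) - x ^ (s + 1)) / (s + 1)) := by
    simp only [Pi.neg_apply, intervalIntegral.integral_neg]
    rw [integral_rpow (Or.inl (by linarith))]
  have hmid := (hconc (y := b) ha).midpoint_le_integral hab.le (hcont ha)
  have htrap₁ := (hconc (y := m) ha).integral_le_trapezoid ham.le (hcont ha)
  have htrap₂ := (hconc (y := b) hm0).integral_le_trapezoid hmb.le (hcont hm0)
  rw [hint] at hmid htrap₁ htrap₂
  simp only [Pi.neg_apply, ← hm] at hmid htrap₁ htrap₂
  have hupper : (b ^ (s + 1) - a ^ (s + 1)) / ((s + 1) * (b - a)) ≤ m ^ s := by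
    rw [← div_div, div_le_iff₀ hba]
    linarith
  have hlower : (a ^ s + 2 * m ^ s + b ^ s) / 4
      ≤ (b ^ (s + 1) - a ^ (s + 1)) / ((s + 1) * (b - a)) := by
    rw [← div_div, le_div_iff₀ hba]
    rw [show m - a = (b - a) / 2 by rw [hm]; ring] at htrap₁
    rw [show b - m = (b - a) / 2 by rw [hm]; ring] at htrap₂
    rw [sub_div] at htrap₁ htrap₂ ⊢
    linarith
  have hdiff := rpow_sub_rpow_le_of_lt_one ha ham.le hs0 hs1.le
  have hmono : m ^ s ≤ b ^ s := Real.rpow_le_rpow hm0.le hmb.le hs0.le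
  have hpow {x : ℝ} (hx : 0 < x) : x ^ (q * (s - 1)) = (x ^ (s - 1)) ^ q := by
    rw [mul_comm, Real.rpow_mul hx.le]
  have ha' : 0 < a ^ (s - 1) := Real.rpow_pos_of_pos ha _
  have hm' : 0 < m ^ (s - 1) := Real.rpow_pos_of_pos hm0 _
  have hb' : 0 < b ^ (s - 1) := Real.rpow_pos_of_pos hb0 _
  rw [abs_of_nonneg (sub_nonneg.2 hupper), hpow ha, hpow hm0, hpow hb0]
  calc m ^ s - (b ^ (s + 1) - a ^ (s + 1)) / ((s + 1) * (b - a))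
      ≤ (m ^ s - a ^ s) / 4 := by linarith
    _ ≤ s * ((m - a) * ((a ^ (s - 1) + m ^ (s - 1)) / 2)) / 4 := by gcongr
    _ = s * ((b - a) / 4) * (1 / 2) * (0 + (a ^ (s - 1) + m ^ (s - 1)) / 2) := by
      rw [hm]; ring
    _ ≤ _ := by
      gcongr
      · exact half_le_one_div_add_one_rpow hp.le
      · positivity
      · exact add_div_two_le_rpow_mean ha'.le hm'.le hq.le (by linarith) (by linarith)
end

section
/- Let 0 < a < b, s ∈ (0, 1), and q ≥ 1. Then |A^s(a, b) − L_s^s(a, b)| ≤ s · ((b−a)/8) · (2/3)^{1/q} · { [A(a^{q(s−1)}, 3b^{q(s−1)})]^{1/q} + [A(3a^{q(s−1)}, b^{q(s−1)})]^{1/q} }, where A(u, v) = (u+v)/2. -/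
/-- The concave power `x ↦ x ^ s` lies below its tangent lines. -/
theorem rpow_le_tangent_line {s x y : ℝ} (hs0 : 0 ≤ s) (hs1 : s ≤ 1) (hx : 0 < x) (hy : 0 ≤ y) :
    y ^ s ≤ x ^ s + s * x ^ (s - 1) * (y - x) := by
  have h := rpow_one_add_le_one_add_mul_self (s := y / x - 1)
    (by linarith [div_nonneg hy hx.le]) hs0 hs1
  rw [add_sub_cancel, Real.div_rpow hy hx.le, div_le_iff₀ (Real.rpow_pos_of_pos hx s)] at h
  rw [Real.rpow_sub_one hx.ne']
  refine h.trans_eq ?_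
  field_simp

/-- The integral of an affine function, written in terms of the displacement from `c`. -/
theorem integral_const_add_mul_sub (a b c k d : ℝ) :
    ∫ x in a..b, (k + d * (x - c)) = k * (b - a) + d * ((b - c) ^ 2 - (a - c) ^ 2) / 2 := by
  rw [intervalIntegral.integral_add (by simp)
    (Continuous.intervalIntegrable (by fun_prop) _ _), intervalIntegral.integral_const_mul,
    intervalIntegral.integral_sub (by simp) (by simp)]
  simp
  ring

/-- A midpoint estimate for the integral of `x ^ s`, involving only the derivative at the left
endpoint. -/
theorem abs_midpoint_sub_average_rpow_le {a b s : ℝ} (ha : 0 < a) (hab : a < b)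
    (hs0 : 0 ≤ s) (hs1 : s ≤ 1) :
    |((a + b) / 2) ^ s - (b ^ (s + 1) - a ^ (s + 1)) / ((s + 1) * (b - a))|
      ≤ s * ((b - a) / 8) * a ^ (s - 1) := by
  have hba : 0 < b - a := sub_pos.2 hab
  obtain ⟨m, hm⟩ : ∃ m, m = (a + b) / 2 := ⟨_, rfl⟩
  rw [← hm]
  have ham : a ≤ m := by linarith
  have hmb : m ≤ b := by linarith
  have hm0 : 0 < m := ha.trans_le ham
  have hint (u v : ℝ) : IntervalIntegrable (fun x : ℝ => x ^ s) MeasureTheory.volume u v :=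
    (Real.continuous_rpow_const hs0).intervalIntegrable u v
  have haff (k d u v : ℝ) :
      IntervalIntegrable (fun x : ℝ => k + d * (x - m)) MeasureTheory.volume u v :=
    Continuous.intervalIntegrable (by fun_prop) u v
  have upper := intervalIntegral.integral_mono_on hab.le (hint a b)
    (haff (m ^ s) (s * m ^ (s - 1)) a b)
    fun x hx => rpow_le_tangent_line hs0 hs1 hm0 (ha.le.trans hx.1)
  have left := intervalIntegral.integral_mono_on ham (haff (m ^ s) (s * a ^ (s - 1)) a m)
    (hint a m) fun x hx => by
      have hx0 := ha.trans_le hx.1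
      have h1 := rpow_le_tangent_line hs0 hs1 hx0 hm0.le
      have h2 : x ^ (s - 1) ≤ a ^ (s - 1) :=
        Real.rpow_le_rpow_of_nonpos ha hx.1 (by linarith)
      have h3 := mul_le_mul_of_nonneg_right (mul_le_mul_of_nonneg_left h2 hs0)
        (sub_nonneg.2 hx.2)
      linarith
  have right := intervalIntegral.integral_mono_on hmb (haff (m ^ s) 0 m b) (hint m b)
    fun x hx => by simpa using Real.rpow_le_rpow hm0.le hx.1 hs0
  have split := intervalIntegral.integral_add_adjacent_intervals (hint a m) (hint m b)
  have value : ∫ x in a..b, x ^ s = (b ^ (s + 1) - a ^ (s + 1)) / (s + 1) :=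
    integral_rpow (Or.inl (by linarith))
  rw [integral_const_add_mul_sub] at upper left right
  rw [← div_div, ← value]
  set I := ∫ x in a..b, x ^ s
  have hb : b = 2 * m - a := by linarith
  have lower_le : I / (b - a) ≤ m ^ s := by
    rw [div_le_iff₀ hba]
    subst hb
    linarith
  rw [abs_of_nonneg (sub_nonneg.2 lower_le), sub_le_comm, le_div_iff₀ hba]
  subst hb
  linarith

/-- Proposition 3.3: inequality between the arithmetic mean and the `s`-logarithmic
mean, with `q ≥ 1`.  Here `A(u,v) = (u+v)/2` and
`L_s^s(a,b) = (b^{s+1} − a^{s+1})/((s+1)(b−a))`. -/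
theorem means_sconvex_power_mean
    (a b s q : ℝ) (ha : 0 < a) (hab : a < b) (hs : s ∈ Set.Ioo (0:ℝ) 1) (hq : 1 ≤ q) :
    |((a + b) / 2) ^ s - (b ^ (s + 1) - a ^ (s + 1)) / ((s + 1) * (b - a))|
      ≤ s * ((b - a) / 8) * ((2:ℝ) / 3) ^ (1 / q) *
        (((a ^ (q * (s - 1)) + 3 * b ^ (q * (s - 1))) / 2) ^ (1 / q)
          + ((3 * a ^ (q * (s - 1)) + b ^ (q * (s - 1))) / 2) ^ (1 / q)) := by
  have hq0 : 0 < q := by linarith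
  have hA : 0 < a ^ (q * (s - 1)) := Real.rpow_pos_of_pos ha _
  have hB : 0 < b ^ (q * (s - 1)) := Real.rpow_pos_of_pos (ha.trans hab) _
  have hroot : a ^ (s - 1) = (a ^ (q * (s - 1))) ^ (1 / q) := by
    rw [← Real.rpow_mul ha.le]
    congr 1
    field_simp
  refine (abs_midpoint_sub_average_rpow_le ha hab hs.1.le hs.2.le).trans ?_
  rw [mul_assoc (s * ((b - a) / 8))]
  refine mul_le_mul_of_nonneg_left ?_ (mul_nonneg hs.1.le (by linarith))
  rw [hroot, mul_add, ← Real.mul_rpow (by norm_num) (by positivity),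
    ← Real.mul_rpow (by norm_num) (by positivity)]
  refine le_add_of_nonneg_of_le (by positivity) ?_
  exact Real.rpow_le_rpow hA.le (by linarith) (by positivity)
end

section
/- Let f : I ⊆ [0, ∞) → ℝ be differentiable on I°, a, b ∈ I with a < b, and f' integrable on [a, b]. Let p > 1 and q with 1/p + 1/q = 1, and suppose |f'|^q is convex on [a, b]. Let d : a = x_0 < x_1 < ... < x_n = b be any division of [a, b], and set T(f, d) = Σ_{i=0}^{n−1} f((x_i + x_{i+1})/2)(x_{i+1} − x_i) and E(f, d) = ∫_a^b f(x) dx − T(f, d). Then |E(f, d)| ≤ (1/(4(p+1)^{1/p})) · Σ_{i=0}^{n−1} (x_{i+1} − x_i)^2 [ |f'(x_{i+1})| + |f'(x_i)| ]. -/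
open Set MeasureTheory intervalIntegral

/-- Mean value bounds on the increments of `f` from bounds on its derivative `g`. -/
lemma increment_mem_Icc_of_hasDerivAt {f g : ℝ → ℝ} {u v lo hi s t : ℝ}
    (hf : ∀ z ∈ Ioo u v, HasDerivAt f (g z) z) (hs : u < s) (hst : s ≤ t) (ht : t < v)
    (hg : ∀ z ∈ Ioo s t, lo ≤ g z ∧ g z ≤ hi) :
    f t - f s ∈ Icc (lo * (t - s)) (hi * (t - s)) := by
  rcases hst.eq_or_lt with rfl | hlt
  · simp
  have hsub : ∀ z ∈ Icc s t, z ∈ Ioo u v := fun z hz =>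
    ⟨hs.trans_le hz.1, hz.2.trans_lt ht⟩
  obtain ⟨z, hz, hzeq⟩ := exists_hasDerivAt_eq_slope f g hlt
    (fun z hz => (hf z (hsub z hz)).continuousAt.continuousWithinAt)
    (fun z hz => hf z (hsub z (Ioo_subset_Icc_self hz)))
  have hpos : 0 < t - s := sub_pos.2 hlt
  have heq : f t - f s = g z * (t - s) := by
    rw [hzeq]; field_simp
  rw [heq]
  exact ⟨mul_le_mul_of_nonneg_right (hg z hz).1 hpos.le,
    mul_le_mul_of_nonneg_right (hg z hz).2 hpos.le⟩

/-- A function with bounded derivative on `(u, v)` is integrable on `[u, v]`. -/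
lemma intervalIntegrable_of_hasDerivAt_bounded {f g : ℝ → ℝ} {u v M : ℝ} (huv : u < v)
    (hf : ∀ z ∈ Ioo u v, HasDerivAt f (g z) z) (hM : ∀ z ∈ Ioo u v, |g z| ≤ M) :
    IntervalIntegrable f volume u v := by
  rw [intervalIntegrable_iff_integrableOn_Ioo_of_le huv.le]
  set m := (u + v) / 2 with hm
  have hum : u < m := by linarith
  have hmv : m < v := by linarith
  have hM0 : 0 ≤ M := (abs_nonneg _).trans (hM m ⟨hum, hmv⟩)
  refine IntegrableOn.of_bound (by simp)
    (ContinuousOn.aestronglyMeasurable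
      (fun z hz => (hf z hz).continuousAt.continuousWithinAt) measurableSet_Ioo)
    (|f m| + M * (v - u)) ?_
  refine (ae_restrict_iff' measurableSet_Ioo).2 (Filter.Eventually.of_forall fun t ht => ?_)
  have key : ∀ s r, u < s → s ≤ r → r < v → |f r - f s| ≤ M * (v - u) := by
    intro s r hs hsr hr
    have h := increment_mem_Icc_of_hasDerivAt hf hs hsr hr (lo := -M) (hi := M)
      (fun z hz => abs_le.1 (hM z ⟨hs.trans hz.1, hz.2.trans hr⟩))
    have hle : M * (r - s) ≤ M * (v - u) := by gcongr
    rw [abs_le]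
    constructor <;> linarith [h.1, h.2]
  have hft : |f t - f m| ≤ M * (v - u) := by
    rcases le_total m t with h | h
    · exact key m t hum h ht.2
    · rw [abs_sub_comm]; exact key t m ht.1 h hmv
  rw [Real.norm_eq_abs]
  calc |f t| = |f m + (f t - f m)| := by ring_nf
    _ ≤ |f m| + |f t - f m| := abs_add_le _ _
    _ ≤ _ := by gcongr

/-- One-sided midpoint error estimate from a piecewise linear majorant. -/
lemma integral_sub_midpoint_le {f : ℝ → ℝ} {u v k c₁ c₂ : ℝ} (huv : u < v)
    (hint : IntervalIntegrable f volume u v)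
    (h₁ : ∀ t ∈ Ioo u ((u + v) / 2), f t - k ≤ c₁ * ((u + v) / 2 - t))
    (h₂ : ∀ t ∈ Ioo ((u + v) / 2) v, f t - k ≤ c₂ * (t - (u + v) / 2)) :
    (∫ t in u..v, f t) - k * (v - u) ≤ (c₁ + c₂) * (v - u) ^ 2 / 8 := by
  set m := (u + v) / 2 with hm
  have hum : u ≤ m := by linarith
  have hmv : m ≤ v := by linarith
  have i₁ : IntervalIntegrable f volume u m :=
    hint.mono_set (by rw [uIcc_of_le hum, uIcc_of_le huv.le]; exact Icc_subset_Icc_right hmv)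
  have i₂ : IntervalIntegrable f volume m v :=
    hint.mono_set (by rw [uIcc_of_le hmv, uIcc_of_le huv.le]; exact Icc_subset_Icc_left hum)
  have e₁ : ∫ t in u..m, f t ≤ ∫ t in u..m, (k + c₁ * (m - t)) :=
    integral_mono_on_of_le_Ioo hum i₁ (Continuous.intervalIntegrable (by fun_prop) _ _)
      (fun t ht => by linarith [h₁ t ht])
  have e₂ : ∫ t in m..v, f t ≤ ∫ t in m..v, (k + c₂ * (t - m)) :=
    integral_mono_on_of_le_Ioo hmv i₂ (Continuous.intervalIntegrable (by fun_prop) _ _)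
      (fun t ht => by linarith [h₂ t ht])
  have c₁' : ∫ t in u..m, (k + c₁ * (m - t)) = k * (m - u) + c₁ * (m - u) ^ 2 / 2 := by
    rw [integral_add (by simp) (Continuous.intervalIntegrable (by fun_prop) _ _),
      intervalIntegral.integral_const_mul,
      intervalIntegral.integral_sub (by simp) (by simp), integral_id]
    simp only [intervalIntegral.integral_const, smul_eq_mul]
    ring
  have c₂' : ∫ t in m..v, (k + c₂ * (t - m)) = k * (v - m) + c₂ * (v - m) ^ 2 / 2 := by
    rw [integral_add (by simp) (Continuous.intervalIntegrable (by fun_prop) _ _),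
      intervalIntegral.integral_const_mul,
      intervalIntegral.integral_sub (by simp) (by simp), integral_id]
    simp only [intervalIntegral.integral_const, smul_eq_mul]
    ring
  rw [← integral_add_adjacent_intervals i₁ i₂]
  have hmu : m - u = (v - u) / 2 := by rw [hm]; ring
  have hvm : v - m = (v - u) / 2 := by rw [hm]; ring
  rw [c₁', hmu] at e₁
  rw [c₂', hvm] at e₂
  linarith

/-- Midpoint error estimate when the derivative is nonnegative from some point `c`, not
beyond the midpoint, onwards. -/
lemma abs_integral_sub_midpoint_le_of_nonneg_right {f g : ℝ → ℝ} {u v c α β : ℝ} (huv : u < v)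
    (hf : ∀ z ∈ Ioo u v, HasDerivAt f (g z) z) (hα : 0 ≤ α) (hβ : 0 ≤ β)
    (hcm : c ≤ (u + v) / 2)
    (hleft : ∀ z ∈ Ioc u c, |g z| ≤ α) (hright : ∀ z ∈ Ioo c v, 0 ≤ g z ∧ g z ≤ β) :
    |(∫ t in u..v, f t) - f ((u + v) / 2) * (v - u)| ≤ (α + β) * (v - u) ^ 2 / 8 := by
  have hbd : ∀ z ∈ Ioo u v, |g z| ≤ α + β := by
    intro z hz
    rcases le_or_gt z c with h | h
    · linarith [hleft z ⟨hz.1, h⟩]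
    · have := hright z ⟨h, hz.2⟩
      rw [abs_of_nonneg this.1]; linarith
  have hint := intervalIntegrable_of_hasDerivAt_bounded huv hf hbd
  have hum : u < (u + v) / 2 := by linarith
  have hmv : (u + v) / 2 < v := by linarith
  have up := integral_sub_midpoint_le (k := f ((u + v) / 2)) (c₁ := α) (c₂ := β) huv hint
    (fun t ht => by
      rcases le_or_gt t c with h | h
      · have d₁ := (increment_mem_Icc_of_hasDerivAt hf ht.1 h (hcm.trans_lt hmv)
          (lo := -α) (hi := α)
          (fun z hz => abs_le.1 (hleft z ⟨ht.1.trans hz.1, hz.2.le⟩))).1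
        have d₂ := (increment_mem_Icc_of_hasDerivAt hf (ht.1.trans_le h) hcm hmv
          (lo := 0) (hi := β) (fun z hz => hright z ⟨hz.1, hz.2.trans hmv⟩)).1
        nlinarith [mul_nonneg hα (sub_nonneg.2 hcm)]
      · have d := (increment_mem_Icc_of_hasDerivAt hf ht.1 ht.2.le hmv
          (lo := 0) (hi := β) (fun z hz => hright z ⟨h.trans hz.1, hz.2.trans hmv⟩)).1
        nlinarith [mul_nonneg hα (sub_nonneg.2 ht.2.le)])
    (fun t ht => (increment_mem_Icc_of_hasDerivAt hf hum ht.1.le ht.2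
      (fun z hz => hright z ⟨hcm.trans_lt hz.1, hz.2.trans ht.2⟩)).2)
  have lo := integral_sub_midpoint_le (f := fun t => -f t) (k := -f ((u + v) / 2))
    (c₁ := α + β) (c₂ := 0) huv hint.neg
    (fun t ht => by
      have d := (increment_mem_Icc_of_hasDerivAt hf ht.1 ht.2.le hmv
        (lo := -(α + β)) (hi := α + β)
        (fun z hz => abs_le.1 (hbd z ⟨ht.1.trans hz.1, hz.2.trans hmv⟩))).2
      linarith)
    (fun t ht => by
      have d := (increment_mem_Icc_of_hasDerivAt hf hum ht.1.le ht.2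
        (lo := 0) (hi := β)
        (fun z hz => hright z ⟨hcm.trans_lt hz.1, hz.2.trans ht.2⟩)).1
      linarith)
  rw [intervalIntegral.integral_neg] at lo
  rw [abs_le]
  constructor <;> linarith

/-- Midpoint error estimate when the derivative has constant sign from some point `c`, not
beyond the midpoint, onwards. -/
lemma abs_integral_sub_midpoint_le_of_sign_right {f g : ℝ → ℝ} {u v c α β : ℝ} (huv : u < v)
    (hf : ∀ z ∈ Ioo u v, HasDerivAt f (g z) z) (hα : 0 ≤ α) (hβ : 0 ≤ β)
    (hcm : c ≤ (u + v) / 2)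
    (hleft : ∀ z ∈ Ioc u c, |g z| ≤ α) (hright : ∀ z ∈ Ioo c v, |g z| ≤ β)
    (hsign : (∀ z ∈ Ioo c v, 0 ≤ g z) ∨ (∀ z ∈ Ioo c v, g z ≤ 0)) :
    |(∫ t in u..v, f t) - f ((u + v) / 2) * (v - u)| ≤ (α + β) * (v - u) ^ 2 / 8 := by
  rcases hsign with h | h
  · exact abs_integral_sub_midpoint_le_of_nonneg_right huv hf hα hβ hcm hleft
      (fun z hz => ⟨h z hz, (le_abs_self _).trans (hright z hz)⟩)
  · have := abs_integral_sub_midpoint_le_of_nonneg_right (f := fun t => -f t)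
      (g := fun t => -g t) huv (fun z hz => (hf z hz).neg) hα hβ hcm
      (fun z hz => by rw [abs_neg]; exact hleft z hz)
      (fun z hz => ⟨by linarith [h z hz], (neg_le_abs _).trans (hright z hz)⟩)
    rw [intervalIntegral.integral_neg, ← abs_neg] at this
    convert this using 2
    ring

/-- A derivative that vanishes everywhere to the left of each of its zeros has constant sign. -/
lemma sign_of_hasDerivAt {f g : ℝ → ℝ} {c v : ℝ}
    (hf : ∀ z ∈ Ioo c v, HasDerivAt f (g z) z)
    (hzero : ∀ s ∈ Ioo c v, ∀ d ∈ Ioo c v, s < d → g d = 0 → g s = 0) :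
    (∀ z ∈ Ioo c v, 0 ≤ g z) ∨ (∀ z ∈ Ioo c v, g z ≤ 0) := by
  by_contra! hcon
  obtain ⟨⟨s, hs, hgs⟩, r, hr, hgr⟩ := hcon
  have hsub : uIcc s r ⊆ Ioo c v := (ordConnected_Ioo).uIcc_subset hs hr
  have hne : ∃ d ∈ uIcc s r, g d = 0 := by
    by_contra! hne
    rcases hasDerivWithinAt_forall_lt_or_forall_gt_of_forall_ne (f' := g) (m := 0)
      (convex_uIcc s r) (fun z hz => (hf z (hsub hz)).hasDerivWithinAt) hne with h | h
    · linarith [h r right_mem_uIcc]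
    · linarith [h s left_mem_uIcc]
  obtain ⟨d, hd, hgd⟩ := hne
  have hds : s ≠ d := fun h => by rw [h] at hgs; linarith
  have hdr : r ≠ d := fun h => by rw [h] at hgr; linarith
  rcases le_total s r with h | h
  · rw [uIcc_of_le h] at hd
    linarith [hzero s hs d (hsub (by rwa [uIcc_of_le h])) (hd.1.lt_of_ne hds) hgd]
  · rw [uIcc_of_ge h] at hd
    linarith [hzero r hr d (hsub (by rwa [uIcc_of_ge h])) (hd.1.lt_of_ne hdr) hgd]

/-- Midpoint error estimate for a quasiconvex `|g|` vanishing somewhere to the left of the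
midpoint. -/
lemma abs_integral_sub_midpoint_le_of_zero_left {f g : ℝ → ℝ} {u v c : ℝ} (huv : u < v)
    (hf : ∀ z ∈ Ioo u v, HasDerivAt f (g z) z)
    (hq : ∀ s ∈ Icc u v, ∀ r ∈ Icc u v, ∀ t ∈ Icc s r, |g t| ≤ max |g s| |g r|)
    (huc : u < c) (hcm : c ≤ (u + v) / 2) (hgc : g c = 0) :
    |(∫ t in u..v, f t) - f ((u + v) / 2) * (v - u)|
      ≤ (|g u| + |g v|) * (v - u) ^ 2 / 8 := by
  have hcv : c < v := by linarith
  have hc : c ∈ Icc u v := ⟨huc.le, hcv.le⟩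
  refine abs_integral_sub_midpoint_le_of_sign_right huv hf (abs_nonneg _) (abs_nonneg _)
    hcm (fun z hz => ?_) (fun z hz => ?_)
    (sign_of_hasDerivAt (f := f) (fun z hz => hf z ⟨huc.trans hz.1, hz.2⟩)
      (fun s hs d hd hsd hgd => ?_))
  · simpa [hgc] using hq u (left_mem_Icc.2 huv.le) c hc z ⟨hz.1.le, hz.2⟩
  · simpa [hgc] using hq c hc v (right_mem_Icc.2 huv.le) z ⟨hz.1.le, hz.2.le⟩
  · simpa [hgc, hgd] using hq c hc d ⟨(huc.trans hd.1).le, hd.2.le⟩ s ⟨hs.1.le, hsd.le⟩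

/-- Midpoint error estimate for a function whose derivative has quasiconvex absolute value. -/
lemma abs_integral_sub_midpoint_le_of_quasiconvex {f g : ℝ → ℝ} {u v : ℝ} (huv : u < v)
    (hf : ∀ z ∈ Ioo u v, HasDerivAt f (g z) z)
    (hq : ∀ s ∈ Icc u v, ∀ r ∈ Icc u v, ∀ t ∈ Icc s r, |g t| ≤ max |g s| |g r|) :
    |(∫ t in u..v, f t) - f ((u + v) / 2) * (v - u)|
      ≤ (|g u| + |g v|) * (v - u) ^ 2 / 8 := by
  by_cases hz : ∃ c ∈ Ioo u v, g c = 0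
  · obtain ⟨c, hc, hgc⟩ := hz
    rcases le_total c ((u + v) / 2) with hcm | hcm
    · exact abs_integral_sub_midpoint_le_of_zero_left huv hf hq hc.1 hcm hgc
    · have hrefl : ∀ z ∈ Ioo u v, HasDerivAt (fun t => f (u + v - t)) (-g (u + v - z)) z :=
        fun z hz => by
          have h := hf (u + v - z) ⟨by linarith [hz.2], by linarith [hz.1]⟩
          exact h.comp_const_sub (u + v) z
      have := abs_integral_sub_midpoint_le_of_zero_left (c := u + v - c)
        (g := fun t => -g (u + v - t)) huv hrefl
        (fun s hs r hr t ht => by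
          simp only [abs_neg]
          rw [max_comm]
          exact hq _ ⟨by linarith [hr.2], by linarith [hr.1]⟩ _
            ⟨by linarith [hs.2], by linarith [hs.1]⟩ _
            ⟨by linarith [ht.2], by linarith [ht.1]⟩)
        (by linarith [hc.2]) (by linarith) (by simpa using hgc)
      rw [intervalIntegral.integral_comp_sub_left (fun t => f t) (u + v)] at this
      have hmid : u + v - (u + v) / 2 = (u + v) / 2 := by ring
      simpa [hmid, add_comm |g v|] using this
  · push Not at hz
    have hM : ∀ z ∈ Ioo u v, |g z| ≤ |g u| + |g v| := fun z hz =>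
      (hq u (left_mem_Icc.2 huv.le) v (right_mem_Icc.2 huv.le) z
        (Ioo_subset_Icc_self hz)).trans
        (max_le_add_of_nonneg (abs_nonneg _) (abs_nonneg _))
    have := abs_integral_sub_midpoint_le_of_sign_right (c := u) (α := 0)
      (β := |g u| + |g v|) huv hf le_rfl (by positivity) (by linarith)
      (fun z hz => absurd hz (by simp)) hM
      (sign_of_hasDerivAt hf (fun s _ d hd _ hgd => absurd hgd (hz d hd)))
    simpa using this

/-- Bernoulli's inequality gives `(p + 1)^(1/p) ≤ 2`. -/
lemma add_one_rpow_one_div_le_two {p : ℝ} (hp : 1 ≤ p) : (p + 1) ^ (1 / p) ≤ 2 := by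
  have hp0 : 0 < p := by linarith
  have h := one_add_mul_self_le_rpow_one_add (s := 1) (by norm_num) hp
  calc (p + 1) ^ (1 / p) ≤ ((2 : ℝ) ^ p) ^ (1 / p) := by
        apply Real.rpow_le_rpow (by linarith) _ (by positivity)
        norm_num at h; linarith
    _ = 2 := by
        rw [← Real.rpow_mul (by norm_num), mul_one_div_cancel hp0.ne', Real.rpow_one]

/-- Proposition 4.1: midpoint quadrature error estimate when `|f'|^q` is convex on
`[a, b]`.  For a division `a = x 0 < x 1 < ... < x n = b`, the error
`E(f,d) = ∫_a^b f − Σ_i f((x_i + x_{i+1})/2)(x_{i+1} − x_i)` satisfies the stated bound. -/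
theorem midpoint_quadrature_error_holder
    (f : ℝ → ℝ) (I : Set ℝ) (hI : Convex ℝ I) (hI0 : I ⊆ Ici (0:ℝ))
    (a b : ℝ) (ha : a ∈ I) (hb : b ∈ I) (hab : a < b)
    (hdiff : DifferentiableOn ℝ f (interior I))
    (hint : IntervalIntegrable (deriv f) volume a b)
    (p q : ℝ) (hp : 1 < p) (hpq : 1 / p + 1 / q = 1)
    (hconv : ConvexOn ℝ (Icc a b) (fun t => |deriv f t| ^ q))
    (n : ℕ) (x : ℕ → ℝ) (hx0 : x 0 = a) (hxn : x n = b)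
    (hmono : ∀ i < n, x i < x (i + 1)) :
    |(∫ u in a..b, f u)
        - ∑ i ∈ Finset.range n, f ((x i + x (i + 1)) / 2) * (x (i + 1) - x i)|
      ≤ 1 / (4 * (p + 1) ^ (1 / p)) *
        ∑ i ∈ Finset.range n,
          (x (i + 1) - x i) ^ 2 * (|deriv f (x (i + 1))| + |deriv f (x i)|) := by
  have hx : MonotoneOn x (Icc 0 n) := by
    refine monotoneOn_of_le_succ ordConnected_Icc fun i _ _ hi => ?_
    exact (hmono i (Nat.lt_of_succ_le hi.2)).le
  have hq0 : 0 < q := by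
    have h : 1 / p < 1 := by rw [div_lt_one (by linarith)]; exact hp
    exact one_div_pos.1 (by linarith)
  have hquasi : ∀ s ∈ Icc a b, ∀ r ∈ Icc a b, ∀ t ∈ Icc s r,
      |deriv f t| ≤ max |deriv f s| |deriv f r| := by
    intro s hs r hr t ht
    have h := hconv.le_max_of_mem_Icc hs hr ht
    rcases le_max_iff.1 h with h | h
    · exact le_max_of_le_left ((Real.rpow_le_rpow_iff (abs_nonneg _) (abs_nonneg _) hq0).1 h)
    · exact le_max_of_le_right ((Real.rpow_le_rpow_iff (abs_nonneg _) (abs_nonneg _) hq0).1 h)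
  have hderiv : ∀ z ∈ Ioo a b, HasDerivAt f (deriv f z) z := by
    have hsub : Ioo a b ⊆ interior I :=
      interior_maximal (Ioo_subset_Icc_self.trans (hI.ordConnected.out ha hb)) isOpen_Ioo
    exact fun z hz =>
      (hdiff.differentiableAt (isOpen_interior.mem_nhds (hsub hz))).hasDerivAt
  have hmem : ∀ i ≤ n, x i ∈ Icc a b := fun i hi =>
    ⟨hx0 ▸ hx ⟨le_rfl, Nat.zero_le n⟩ ⟨Nat.zero_le i, hi⟩ (Nat.zero_le i),
      hxn ▸ hx ⟨Nat.zero_le i, hi⟩ ⟨Nat.zero_le n, le_rfl⟩ hi⟩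
  have hint' : IntervalIntegrable f volume a b :=
    intervalIntegrable_of_hasDerivAt_bounded hab hderiv fun z hz =>
      hquasi a (left_mem_Icc.2 hab.le) b (right_mem_Icc.2 hab.le) z (Ioo_subset_Icc_self hz)
  have hsum : ∫ u in a..b, f u = ∑ i ∈ Finset.range n, ∫ u in x i..x (i + 1), f u := by
    rw [sum_integral_adjacent_intervals, hx0, hxn]
    intro i hi
    refine hint'.mono_set ?_
    rw [uIcc_of_le hab.le]
    exact ordConnected_Icc.uIcc_subset (hmem i hi.le) (hmem (i + 1) hi)
  have hC : (1 : ℝ) / 8 ≤ 1 / (4 * (p + 1) ^ (1 / p)) := by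
    have h2 := add_one_rpow_one_div_le_two hp.le
    have h0 : 0 < (p + 1) ^ (1 / p) := Real.rpow_pos_of_pos (by linarith) _
    exact one_div_le_one_div_of_le (by positivity) (by linarith)
  rw [hsum, ← Finset.sum_sub_distrib, Finset.mul_sum]
  refine (Finset.abs_sum_le_sum_abs _ _).trans (Finset.sum_le_sum fun i hi => ?_)
  have hin : i < n := Finset.mem_range.1 hi
  have hl := hmem i hin.le
  have hr := hmem (i + 1) hin
  have hsub : Icc (x i) (x (i + 1)) ⊆ Icc a b := Icc_subset_Icc hl.1 hr.2
  have key := abs_integral_sub_midpoint_le_of_quasiconvex (hmono i hin)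
    (fun z hz => hderiv z ⟨hl.1.trans_lt hz.1, hz.2.trans_le hr.2⟩)
    (fun s hs r hr t ht => hquasi s (hsub hs) r (hsub hr) t ht)
  calc _ ≤ _ := key
    _ = 1 / 8 * ((x (i + 1) - x i) ^ 2 * (|deriv f (x (i + 1))| + |deriv f (x i)|)) := by ring
    _ ≤ _ := by gcongr
end
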